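/- arXiv:1808.03158 — 3 statements merged into one kernel-verified Lean document; each statement's English description precedes it below -/
import Mathlib

section
/- For every real θ with 0 < θ < 1/2 there exists C > 0 such that for every integer N ≥ 1 and every n ∈ ℤ³, ∑_{m∈ℤ³, |m| > N} ⟨m⟩^{-2}⟨n−m⟩^{-2} ≤ C N^{-2θ} ⟨n⟩^{-1+2θ}. -/
open scoped ENNReal NNReal BigOperators

noncomputable section

/-- The square of the Euclidean norm of a lattice point `n ∈ ℤ³`, as a real number. -/
def nsqR (n : Fin 3 → ℤ) : ℝ := ∑ i, ((n i : ℝ))^2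

/-- The Japanese bracket `⟨n⟩ = (1 + |n|²)^(1/2)`, as an element of `[0,∞]`. -/
def jbE (n : Fin 3 → ℤ) : ℝ≥0∞ := ENNReal.ofReal (Real.sqrt (1 + nsqR n))

theorem tce_bern1 (p x : ℝ) (hp0 : 0 ≤ p) (hp : p < 1) (hx : 1 ≤ x) :
    (1 - p) * x ^ (-p) ≤ x ^ (1 - p) - (x - 1) ^ (1 - p) := by
  have hx0 : 0 < x := by linarith
  have h1 : x⁻¹ ≤ 1 := inv_le_one_of_one_le₀ hx
  have h := rpow_one_add_le_one_add_mul_self (s := -x⁻¹) (by linarith) (p := 1 - p)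
    (by linarith) (by linarith)
  have e : x - 1 = x * (1 + -x⁻¹) := by field_simp; ring
  have e2 : x ^ (-p) = x ^ (1 - p) * x⁻¹ := by
    rw [← Real.rpow_neg_one, ← Real.rpow_add hx0]; congr 1; ring
  rw [e, Real.mul_rpow hx0.le (by linarith), e2]
  have := mul_le_mul_of_nonneg_left h (Real.rpow_nonneg hx0.le (1 - p))
  linarith

theorem tce_bern2 (r x : ℝ) (hr : 0 < r) (hx : 0 < x) :
    r * (x + 1) ^ (-(r + 1)) ≤ x ^ (-r) - (x + 1) ^ (-r) := by
  have hy : 0 < x + 1 := by linarith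
  set y := x + 1 with hyd
  have h1 : y⁻¹ < 1 := inv_lt_one_of_one_lt₀ (by linarith)
  have e : x = y * (1 - y⁻¹) := by field_simp; linarith
  have e2 : y ^ (-(r + 1)) = y ^ (-r) * y⁻¹ := by
    rw [← Real.rpow_neg_one, ← Real.rpow_add hy]; congr 1; ring
  have h : 1 + r * y⁻¹ ≤ (1 - y⁻¹) ^ (-r) := by
    have a : 1 - y⁻¹ ≤ Real.exp (-y⁻¹) := by
      have := Real.add_one_le_exp (-y⁻¹); linarith
    have b := Real.rpow_le_rpow_of_nonpos (by linarith) a (show -r ≤ 0 by linarith)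
    rw [← Real.exp_mul] at b
    have c := Real.add_one_le_exp (-y⁻¹ * -r)
    linarith
  have e3 : x ^ (-r) = y ^ (-r) * (1 - y⁻¹) ^ (-r) := by
    rw [← Real.mul_rpow hy.le (by linarith), ← e]
  rw [e3, e2]
  have := mul_le_mul_of_nonneg_left h (Real.rpow_nonneg hy.le (-r))
  linarith

def tceH (p q R : ℝ) (j : ℕ) : ℝ := ((j : ℝ) + 1) ^ (-p) * (max ((j : ℝ) + 1) R) ^ (-q)

theorem tceH_nonneg (p q R : ℝ) (j : ℕ) : 0 ≤ tceH p q R j := by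
  unfold tceH; positivity

theorem tce_partial (p q R : ℝ) (hp0 : 0 ≤ p) (hp : p < 1) (hpq : 1 < p + q) (hR : 1 ≤ R) (n : ℕ) :
    ((n : ℝ) ≤ R → ∑ j ∈ Finset.range n, tceH p q R j ≤ R ^ (-q) * ((n : ℝ) ^ (1 - p) / (1 - p))) ∧
    (R < n → ∑ j ∈ Finset.range n, tceH p q R j ≤
      R ^ (1 - p - q) * (1 / (1 - p) + 1 + 1 / (p + q - 1)) - (n : ℝ) ^ (1 - p - q) / (p + q - 1)) := by
  have hR0 : 0 < R := by linarith
  have h1p : 0 < 1 - p := by linarith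
  have hr : 0 < p + q - 1 := by linarith
  induction n with
  | zero =>
    refine ⟨fun _ => ?_, fun h => ?_⟩
    · simp only [Finset.range_zero, Finset.sum_empty]; positivity
    · exfalso; push_cast at h; linarith
  | succ n ih =>
    obtain ⟨ih1, ih2⟩ := ih
    rw [Finset.sum_range_succ]
    push_cast
    have hn0 : (0 : ℝ) ≤ n := n.cast_nonneg
    refine ⟨fun h => ?_, fun h => ?_⟩
    · have a := ih1 (by linarith)
      have b : tceH p q R n = ((n : ℝ) + 1) ^ (-p) * R ^ (-q) := by
        unfold tceH; rw [max_eq_right h]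
      have c := tce_bern1 p (n + 1) hp0 hp (by linarith)
      rw [add_sub_cancel_right] at c
      have d : ((n : ℝ) + 1) ^ (-p) ≤ ((n : ℝ) + 1) ^ (1 - p) / (1 - p) - (n : ℝ) ^ (1 - p) / (1 - p) := by
        rw [← sub_div, le_div_iff₀ h1p]; linarith
      have e := mul_le_mul_of_nonneg_left d (Real.rpow_nonneg hR0.le (-q))
      rw [b]; linarith
    · have b : tceH p q R n = ((n : ℝ) + 1) ^ (-(p + q)) := by
        unfold tceH; rw [max_eq_left h.le, ← Real.rpow_add (by linarith)]; congr 1; ring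
      rw [b]
      by_cases hn : (n : ℝ) ≤ R
      · have a := ih1 hn
        have c : (n : ℝ) ^ (1 - p) / (1 - p) ≤ R ^ (1 - p) / (1 - p) := by gcongr
        have d := mul_le_mul_of_nonneg_left c (Real.rpow_nonneg hR0.le (-q))
        have e : R ^ (-q) * (R ^ (1 - p) / (1 - p)) = R ^ (1 - p - q) * (1 / (1 - p)) := by
          rw [show (1 - p - q) = -q + (1 - p) by ring, Real.rpow_add hR0]; ring
        have f : ((n : ℝ) + 1) ^ (-(p + q)) ≤ R ^ (-(p + q)) :=
          Real.rpow_le_rpow_of_nonpos hR0 h.le (by linarith)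
        have g : R ^ (-(p + q)) ≤ R ^ (1 - p - q) :=
          Real.rpow_le_rpow_of_exponent_le hR (by linarith)
        have i : ((n : ℝ) + 1) ^ (1 - p - q) ≤ R ^ (1 - p - q) :=
          Real.rpow_le_rpow_of_nonpos hR0 h.le (by linarith)
        have k : ((n : ℝ) + 1) ^ (1 - p - q) / (p + q - 1) ≤ R ^ (1 - p - q) / (p + q - 1) := by gcongr
        have l : R ^ (1 - p - q) * (1 / (1 - p) + 1 + 1 / (p + q - 1)) =
          R ^ (1 - p - q) * (1 / (1 - p)) + R ^ (1 - p - q) + R ^ (1 - p - q) / (p + q - 1) := by ring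
        linarith
      · push Not at hn
        have a := ih2 hn
        have c := tce_bern2 (p + q - 1) n hr (by linarith)
        rw [show -(p + q - 1 + 1) = -(p + q) by ring, show -(p + q - 1) = 1 - p - q by ring] at c
        have d : ((n : ℝ) + 1) ^ (-(p + q)) ≤
            (n : ℝ) ^ (1 - p - q) / (p + q - 1) - ((n : ℝ) + 1) ^ (1 - p - q) / (p + q - 1) := by
          rw [← sub_div, le_div_iff₀ hr]; linarith
        linarith

theorem tce_nat (p q : ℝ) (hp0 : 0 ≤ p) (hp : p < 1) (hpq : 1 < p + q) :
    ∃ C : ℝ, 0 < C ∧ ∀ R : ℝ, 1 ≤ R →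
      ∑' j : ℕ, ENNReal.ofReal (tceH p q R j) ≤ ENNReal.ofReal (C * R ^ (1 - p - q)) := by
  have h1p : 0 < 1 - p := by linarith
  have hr : 0 < p + q - 1 := by linarith
  refine ⟨1 / (1 - p) + 1 + 1 / (p + q - 1), by positivity, fun R hR => ?_⟩
  have hR0 : 0 < R := by linarith
  apply ENNReal.tsum_le_of_sum_range_le
  intro n
  rw [← ENNReal.ofReal_sum_of_nonneg (fun i _ => tceH_nonneg p q R i)]
  apply ENNReal.ofReal_le_ofReal
  obtain ⟨h1, h2⟩ := tce_partial p q R hp0 hp hpq hR n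
  have hX : 0 < R ^ (1 - p - q) := by positivity
  rcases le_or_gt (n : ℝ) R with h | h
  · refine (h1 h).trans ?_
    have c : (n : ℝ) ^ (1 - p) / (1 - p) ≤ R ^ (1 - p) / (1 - p) := by gcongr
    have d := mul_le_mul_of_nonneg_left c (Real.rpow_nonneg hR0.le (-q))
    have e : R ^ (-q) * (R ^ (1 - p) / (1 - p)) = R ^ (1 - p - q) * (1 / (1 - p)) := by
      rw [show (1 - p - q) = -q + (1 - p) by ring, Real.rpow_add hR0]; ring
    have f : 0 < R ^ (1 - p - q) * (1 + 1 / (p + q - 1)) := by positivity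
    linarith
  · refine (h2 h).trans ?_
    have : 0 ≤ (n : ℝ) ^ (1 - p - q) / (p + q - 1) := by positivity
    linarith

theorem tce_int (h : ℕ → ℝ≥0∞) : ∑' j : ℤ, h j.natAbs ≤ 2 * ∑' j : ℕ, h j := by
  rw [tsum_of_nat_of_neg_add_one ENNReal.summable ENNReal.summable, two_mul]
  refine add_le_add (le_of_eq (by simp)) ?_
  have : ∀ n : ℕ, (-((n : ℤ) + 1)).natAbs = n + 1 := fun n => by omega
  simp only [this]
  exact ENNReal.tsum_comp_le_tsum_of_injective (add_left_injective 1) h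

theorem tce_prod (f : ℤ → ℝ≥0∞) : ∀ d : ℕ,
    ∑' m : Fin d → ℤ, ∏ i, f (m i) = (∑' j, f j) ^ d
  | 0 => by simp [tsum_fintype]
  | d + 1 => by
    rw [← (Fin.consEquiv (fun _ : Fin (d + 1) => ℤ)).tsum_eq, ENNReal.tsum_prod']
    simp only [Fin.consEquiv, Equiv.coe_fn_mk, Fin.prod_univ_succ, Fin.cons_zero, Fin.cons_succ]
    simp only [ENNReal.tsum_mul_left, tce_prod f d, ENNReal.tsum_mul_right]
    rw [pow_succ, mul_comm]

def tceJ (n : Fin 3 → ℤ) : ℝ := Real.sqrt (1 + nsqR n)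

theorem nsqR_nonneg' (n : Fin 3 → ℤ) : 0 ≤ nsqR n := by unfold nsqR; positivity

theorem tceJ_one_le (n : Fin 3 → ℤ) : 1 ≤ tceJ n := by
  unfold tceJ; rw [Real.one_le_sqrt]; linarith [nsqR_nonneg' n]

theorem tceJ_sq (n : Fin 3 → ℤ) : tceJ n ^ 2 = 1 + nsqR n :=
  Real.sq_sqrt (by linarith [nsqR_nonneg' n])

theorem tceJ_coord (n : Fin 3 → ℤ) (i : Fin 3) : ((n i).natAbs : ℝ) + 1 ≤ 2 * tceJ n := by
  have h : ((n i).natAbs : ℝ) ≤ tceJ n := by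
    apply Real.le_sqrt_of_sq_le
    have : ((n i).natAbs : ℝ) ^ 2 = (n i : ℝ) ^ 2 := by
      rw [Nat.cast_natAbs]; push_cast; rw [sq_abs]
    rw [this]
    have := Finset.single_le_sum (f := fun i => ((n i : ℝ)) ^ 2) (fun i _ => sq_nonneg _)
      (Finset.mem_univ i)
    unfold nsqR; linarith
  linarith [tceJ_one_le n]

/-- weak triangle inequality -/
theorem tceJ_tri (n m : Fin 3 → ℤ) : tceJ n ≤ 2 * max (tceJ m) (tceJ (n - m)) := by
  have h1 := tceJ_one_le m
  have hM : 0 ≤ 2 * max (tceJ m) (tceJ (n - m)) := by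
    have := le_max_left (tceJ m) (tceJ (n - m)); linarith
  apply Real.sqrt_le_iff.mpr ⟨hM, ?_⟩
  have a : nsqR n ≤ 2 * nsqR m + 2 * nsqR (n - m) := by
    unfold nsqR
    rw [Finset.mul_sum, Finset.mul_sum, ← Finset.sum_add_distrib]
    apply Finset.sum_le_sum
    intro i _
    simp only [Pi.sub_apply]; push_cast
    nlinarith [sq_nonneg ((n i : ℝ) - 2 * m i)]
  have b : tceJ m ^ 2 ≤ max (tceJ m) (tceJ (n - m)) ^ 2 := by
    gcongr; exact le_max_left _ _
  have c : tceJ (n - m) ^ 2 ≤ max (tceJ m) (tceJ (n - m)) ^ 2 := by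
    have := tceJ_one_le (n - m)
    gcongr; exact le_max_right _ _
  rw [tceJ_sq] at b c
  nlinarith

def tceF (p q R : ℝ) (k : Fin 3 → ℤ) : ℝ := tceJ k ^ (-p) * (max (tceJ k) R) ^ (-q)

theorem tceF_nonneg (p q R : ℝ) (k : Fin 3 → ℤ) : 0 ≤ tceF p q R k := by
  have := tceJ_one_le k
  unfold tceF; positivity

theorem tce_half {x y r : ℝ} (hx : 0 < x) (hr : 0 ≤ r) (h : x ≤ 2 * y) :
    y ^ (-r) ≤ 2 ^ r * x ^ (-r) := by
  have := Real.rpow_le_rpow_of_nonpos hx h (show -r ≤ 0 by linarith)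
  have hy : 0 < y := by linarith
  rw [Real.mul_rpow (by norm_num) hy.le] at this
  have := mul_le_mul_of_nonneg_left this (show (0 : ℝ) ≤ 2 ^ r by positivity)
  rwa [← mul_assoc, ← Real.rpow_add (by norm_num), add_neg_cancel, Real.rpow_zero, one_mul] at this

theorem tceF_le (p q R : ℝ) (hp : 0 ≤ p) (hq : 0 ≤ q) (hR : 1 ≤ R) (k : Fin 3 → ℤ) :
    tceF (3 * p) (3 * q) R k ≤ (2 ^ p * 2 ^ q) ^ 3 * ∏ i, tceH p q R (k i).natAbs := by
  have hJ := tceJ_one_le k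
  have hM : 0 < max (tceJ k) R := lt_of_lt_of_le (by linarith) (le_max_left _ _)
  have e : tceF (3 * p) (3 * q) R k = ∏ _i : Fin 3, (tceJ k ^ (-p) * (max (tceJ k) R) ^ (-q)) := by
    unfold tceF
    rw [Finset.prod_const, Finset.card_univ, Fintype.card_fin, mul_pow, ← Real.rpow_natCast,
      ← Real.rpow_natCast, ← Real.rpow_mul (by linarith), ← Real.rpow_mul hM.le]
    congr 2 <;> (push_cast; ring)
  have e2 : ((2 : ℝ) ^ p * 2 ^ q) ^ 3 = ∏ _i : Fin 3, ((2 : ℝ) ^ p * 2 ^ q) := by simp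
  rw [e, e2, ← Finset.prod_mul_distrib]
  apply Finset.prod_le_prod
  · intro i _; positivity
  · intro i _
    have hc := tceJ_coord k i
    have h1 := tce_half (by positivity) hp hc
    have h2 : max (((k i).natAbs : ℝ) + 1) R ≤ 2 * max (tceJ k) R := by
      apply max_le
      · linarith [le_max_left (tceJ k) R]
      · linarith [le_max_right (tceJ k) R]
    have h3 := tce_half (by positivity) hq h2
    unfold tceH
    calc _ ≤ _ := mul_le_mul h1 h3 (by positivity) (by positivity)
      _ = _ := by ring

theorem tceF_sum (p q : ℝ) (hp0 : 0 ≤ p) (hq0 : 0 ≤ q) (hp : p < 3) (hpq : 3 < p + q) :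
    ∃ C : ℝ, 0 < C ∧ ∀ R : ℝ, 1 ≤ R →
      ∑' k : Fin 3 → ℤ, ENNReal.ofReal (tceF p q R k) ≤ ENNReal.ofReal (C * R ^ (3 - p - q)) := by
  obtain ⟨C, hC, h⟩ := tce_nat (p / 3) (q / 3) (by linarith) (by linarith) (by linarith)
  refine ⟨(2 ^ (p / 3) * 2 ^ (q / 3)) ^ 3 * (2 * C) ^ 3, by positivity, fun R hR => ?_⟩
  have hR0 : 0 < R := by linarith
  have key : ∀ k : Fin 3 → ℤ, ENNReal.ofReal (tceF p q R k) ≤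
      ENNReal.ofReal ((2 ^ (p / 3) * 2 ^ (q / 3)) ^ 3) *
        ∏ i, ENNReal.ofReal (tceH (p / 3) (q / 3) R (k i).natAbs) := by
    intro k
    rw [← ENNReal.ofReal_prod_of_nonneg (fun i _ => tceH_nonneg _ _ _ _),
      ← ENNReal.ofReal_mul (by positivity)]
    apply ENNReal.ofReal_le_ofReal
    have := tceF_le (p / 3) (q / 3) R (by linarith) (by linarith) hR k
    rwa [mul_div_cancel₀ p (by norm_num : (3 : ℝ) ≠ 0),
      mul_div_cancel₀ q (by norm_num : (3 : ℝ) ≠ 0)] at this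
  refine (ENNReal.tsum_le_tsum key).trans ?_
  rw [ENNReal.tsum_mul_left,
    tce_prod (fun j : ℤ => ENNReal.ofReal (tceH (p / 3) (q / 3) R j.natAbs)) 3, mul_assoc,
    ENNReal.ofReal_mul (p := (2 ^ (p / 3) * 2 ^ (q / 3)) ^ 3) (by positivity)]
  refine mul_le_mul_right ?_ _
  have e : (2 * C) ^ 3 * R ^ (3 - p - q) = (2 * (C * R ^ (1 - p / 3 - q / 3))) ^ 3 := by
    rw [show (2 * (C * R ^ (1 - p / 3 - q / 3))) ^ 3 = (2 * C) ^ 3 * (R ^ (1 - p / 3 - q / 3)) ^ 3 by ring,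
      ← Real.rpow_natCast (R ^ (1 - p / 3 - q / 3)), ← Real.rpow_mul hR0.le]
    congr 2; push_cast; ring
  rw [e, ENNReal.ofReal_pow (by positivity)]
  refine pow_le_pow_left' ?_ 3
  refine (tce_int (fun j => ENNReal.ofReal (tceH (p / 3) (q / 3) R j))).trans ?_
  rw [ENNReal.ofReal_mul (by norm_num), ENNReal.ofReal_ofNat]
  exact mul_le_mul_right (h R hR) 2

theorem tce_point (a : ℝ) (ha0 : 0 ≤ a) (ha : a ≤ 2) (n m : Fin 3 → ℤ) :
    tceJ m ^ (-a) * tceJ (n - m) ^ (-2 : ℝ) ≤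
      4 * (tceF a 2 (tceJ n) m + tceF 2 a (tceJ n) (n - m)) := by
  have h1 := tceJ_one_le m
  have h2 := tceJ_one_le (n - m)
  have h3 := tceJ_one_le n
  have t := tceJ_tri n m
  have f1 := tceF_nonneg a 2 (tceJ n) m
  have f2 := tceF_nonneg 2 a (tceJ n) (n - m)
  rcases le_total (tceJ m) (tceJ (n - m)) with h | h
  · rw [max_eq_right h] at t
    have : max (tceJ m) (tceJ n) ≤ 2 * tceJ (n - m) := max_le (by linarith) t
    have g := tce_half (by positivity) (show (0 : ℝ) ≤ 2 by norm_num) this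
    have g' := mul_le_mul_of_nonneg_left g (show 0 ≤ tceJ m ^ (-a) by positivity)
    have e : tceJ m ^ (-a) * ((2 : ℝ) ^ (2 : ℝ) * max (tceJ m) (tceJ n) ^ (-2 : ℝ)) =
      4 * tceF a 2 (tceJ n) m := by
      unfold tceF; rw [Real.rpow_ofNat]; ring
    linarith
  · rw [max_eq_left h] at t
    have : max (tceJ (n - m)) (tceJ n) ≤ 2 * tceJ m := max_le (by linarith) t
    have g := tce_half (by positivity) ha0 this
    have g' := mul_le_mul_of_nonneg_right g (show 0 ≤ tceJ (n - m) ^ (-2 : ℝ) by positivity)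
    have l : (2 : ℝ) ^ a ≤ 4 := by
      have := Real.rpow_le_rpow_of_exponent_le (show (1 : ℝ) ≤ 2 by norm_num) ha
      rw [Real.rpow_ofNat] at this; linarith
    have e : (2 : ℝ) ^ a * max (tceJ (n - m)) (tceJ n) ^ (-a) * tceJ (n - m) ^ (-2 : ℝ) =
      2 ^ a * tceF 2 a (tceJ n) (n - m) := by
      unfold tceF; ring
    have := mul_le_mul_of_nonneg_right l f2
    linarith

theorem jbE_rpow (n : Fin 3 → ℤ) (s : ℝ) : jbE n ^ s = ENNReal.ofReal (tceJ n ^ s) :=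
  ENNReal.ofReal_rpow_of_pos (lt_of_lt_of_le one_pos (tceJ_one_le n))

/-- Tail convolution estimate: for `0 < θ < 1/2`,
`∑_{|m| > N} ⟨m⟩⁻²⟨n−m⟩⁻² ≤ C N^{-2θ} ⟨n⟩^{-1+2θ}` uniformly in `N ≥ 1` and `n ∈ ℤ³`. -/
theorem tail_convolution_estimate (θ : ℝ) (hθ₀ : 0 < θ) (hθ₁ : θ < 1/2) :
    ∃ C : ℝ, 0 < C ∧ ∀ N : ℕ, 1 ≤ N → ∀ n : Fin 3 → ℤ,
      (∑' m : Fin 3 → ℤ,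
          if (N : ℝ)^2 < nsqR m then jbE m ^ (-2 : ℝ) * jbE (n - m) ^ (-2 : ℝ) else 0)
        ≤ ENNReal.ofReal C * (N : ℝ≥0∞) ^ (-(2 * θ)) * jbE n ^ (-1 + 2 * θ) := by
  obtain ⟨C₁, hC₁, H₁⟩ := tceF_sum (2 - 2 * θ) 2 (by linarith) (by linarith) (by linarith) (by linarith)
  obtain ⟨C₂, hC₂, H₂⟩ := tceF_sum 2 (2 - 2 * θ) (by linarith) (by linarith) (by linarith) (by linarith)
  refine ⟨4 * (C₁ + C₂), by positivity, fun N hN n => ?_⟩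
  have hN0 : (0 : ℝ) < N := by exact_mod_cast hN
  have hn1 := tceJ_one_le n
  have key : ∀ m : Fin 3 → ℤ,
      (if (N : ℝ)^2 < nsqR m then jbE m ^ (-2 : ℝ) * jbE (n - m) ^ (-2 : ℝ) else 0) ≤
      ENNReal.ofReal ((N : ℝ) ^ (-(2 * θ)) * 4) *
        (ENNReal.ofReal (tceF (2 - 2 * θ) 2 (tceJ n) m) +
          ENNReal.ofReal (tceF 2 (2 - 2 * θ) (tceJ n) (n - m))) := by
    intro m
    split_ifs with hm
    · have hJ := tceJ_one_le m
      have hJ2 := tceJ_one_le (n - m)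
      rw [jbE_rpow, jbE_rpow, ← ENNReal.ofReal_mul (by positivity),
        ← ENNReal.ofReal_add (tceF_nonneg _ _ _ _) (tceF_nonneg _ _ _ _),
        ← ENNReal.ofReal_mul (by positivity)]
      apply ENNReal.ofReal_le_ofReal
      have hNJ : (N : ℝ) ≤ tceJ m := Real.le_sqrt_of_sq_le (by linarith)
      have e : tceJ m ^ (-2 : ℝ) = tceJ m ^ (-(2 * θ)) * tceJ m ^ (-(2 - 2 * θ)) := by
        rw [← Real.rpow_add (by linarith)]; congr 1; ring
      have l : tceJ m ^ (-(2 * θ)) ≤ (N : ℝ) ^ (-(2 * θ)) :=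
        Real.rpow_le_rpow_of_nonpos hN0 hNJ (by linarith)
      have pt := tce_point (2 - 2 * θ) (by linarith) (by linarith) n m
      rw [e, mul_assoc, mul_assoc]
      exact mul_le_mul l pt (by positivity) (by positivity)
    · exact zero_le
  refine (ENNReal.tsum_le_tsum key).trans ?_
  have hs : ∑' m, ENNReal.ofReal (tceF 2 (2 - 2 * θ) (tceJ n) (n - m)) =
      ∑' m, ENNReal.ofReal (tceF 2 (2 - 2 * θ) (tceJ n) m) :=
    (Equiv.subLeft n).tsum_eq (fun k => ENNReal.ofReal (tceF 2 (2 - 2 * θ) (tceJ n) k))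
  rw [ENNReal.tsum_mul_left, ENNReal.tsum_add, hs]
  have h1 := H₁ (tceJ n) hn1
  have h2 := H₂ (tceJ n) hn1
  rw [show 3 - (2 - 2 * θ) - 2 = -1 + 2 * θ by ring] at h1
  rw [show 3 - 2 - (2 - 2 * θ) = -1 + 2 * θ by ring] at h2
  refine (mul_le_mul_right (add_le_add h1 h2) _).trans (le_of_eq ?_)
  rw [jbE_rpow, ← ENNReal.ofReal_natCast, ENNReal.ofReal_rpow_of_pos hN0,
    ← ENNReal.ofReal_add (by positivity) (by positivity), ← ENNReal.ofReal_mul (by positivity),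
    ← ENNReal.ofReal_mul (by positivity), ← ENNReal.ofReal_mul (by positivity)]
  congr 1; ring
end
end

section
/- Let σ ≥ 1 be a real number and N ∈ ℕ. Let a⁰, b⁰ : ℤ³ → ℂ be Hermitian-symmetric with ‖a⁰‖_{h^σ} < ∞ and ‖b⁰‖_{h^{σ−1}} < ∞. Then there exists exactly one function a : ℝ → (ℤ³ → ℂ) such that for every n ∈ ℤ³ the map t ↦ a(t)(n) is twice continuously differentiable, a(0)(n) = a⁰(n), (∂_t a)(0)(n) = b⁰(n), and (∂_t² a)(t)(n) = −|n|² a(t)(n) − c_N(a(t))(n) for all t ∈ ℝ and n ∈ ℤ³. Moreover, this solution satisfies: a(t) is Hermitian-symmetric for every t ∈ ℝ, and for every T > 0, sup_{t∈[−T,T]} (‖a(t)‖_{h^σ} + ‖(∂_t a)(t)‖_{h^{σ−1}}) < ∞. -/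
open scoped ENNReal NNReal BigOperators

noncomputable section

/-- The square of the Euclidean norm of a lattice point `n ∈ ℤ³`, as an integer. -/
def nsqZ (n : Fin 3 → ℤ) : ℤ := ∑ i, (n i)^2

/-- The squared Sobolev norm `‖a‖²_{h^σ} = ∑_{n∈ℤ³} ⟨n⟩^{2σ}|a(n)|²` in `[0,∞]`,
with `⟨n⟩^{2σ} = (1+|n|²)^σ`. -/
def hNormSq (σ : ℝ) (a : (Fin 3 → ℤ) → ℂ) : ℝ≥0∞ :=
  ∑' n : Fin 3 → ℤ, ENNReal.ofReal ((1 + (nsqZ n : ℝ)) ^ σ) * (‖a n‖₊ : ℝ≥0∞)^2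

/-- Hermitian symmetry `a(−n) = conj(a(n))`, corresponding to real-valued `u`. -/
def HermSymm (a : (Fin 3 → ℤ) → ℂ) : Prop :=
  ∀ n, a (-n) = (starRingEnd ℂ) (a n)

/-- The lattice points `n ∈ ℤ³` with Euclidean norm `|n| ≤ N`, as a finite set. -/
def latticeBall (N : ℕ) : Finset (Fin 3 → ℤ) :=
  (Finset.Icc (fun _ => -(N : ℤ)) (fun _ => (N : ℤ))).filter (fun m => nsqZ m ≤ (N : ℤ)^2)

/-- The truncated cubic convolution `c_N(a)(n)`: zero for `|n| > N`, and
`∑_{n₁+n₂+n₃=n, |nᵢ|≤N} a(n₁)a(n₂)a(n₃)` for `|n| ≤ N`. -/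
def cubicTrunc (N : ℕ) (a : (Fin 3 → ℤ) → ℂ) (n : Fin 3 → ℤ) : ℂ :=
  if nsqZ n ≤ (N : ℤ)^2 then
    ∑ m ∈ latticeBall N, ∑ k ∈ latticeBall N,
      (if nsqZ (n - m - k) ≤ (N : ℤ)^2 then a m * a k * a (n - m - k) else 0)
  else 0


theorem ode_unique_Ioo {E : Type*} [NormedAddCommGroup E] [NormedSpace ℝ E]
    [FiniteDimensional ℝ E] (v : E → E) (hv : ContDiff ℝ 1 v) (T : ℝ) (f g : ℝ → E)
    (hf : ∀ t ∈ Set.Ioo (-T) T, HasDerivAt f (v (f t)) t)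
    (hg : ∀ t ∈ Set.Ioo (-T) T, HasDerivAt g (v (g t)) t)
    (h0 : f 0 = g 0) : ∀ t ∈ Set.Ioo (-T) T, f t = g t := by
  intro t ht
  obtain ⟨S, hS1, hS2⟩ : ∃ S, |t| < S ∧ S < T := exists_between (abs_lt.2 ht)
  have hS0 : 0 < S := (abs_nonneg t).trans_lt hS1
  have hsub : Set.Icc (-S) S ⊆ Set.Ioo (-T) T := fun s hs => ⟨by linarith [hs.1], by linarith [hs.2]⟩
  have hfc : ContinuousOn f (Set.Icc (-S) S) := fun s hs => (hf s (hsub hs)).continuousAt.continuousWithinAt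
  have hgc : ContinuousOn g (Set.Icc (-S) S) := fun s hs => (hg s (hsub hs)).continuousAt.continuousWithinAt
  obtain ⟨C1, hC1⟩ := isCompact_Icc.exists_bound_of_continuousOn hfc
  obtain ⟨C2, hC2⟩ := isCompact_Icc.exists_bound_of_continuousOn hgc
  have : ProperSpace E := FiniteDimensional.proper ℝ E
  obtain ⟨K, hK⟩ := hv.contDiffOn.exists_lipschitzOnWith (s := Metric.closedBall (0:E) (max C1 C2)) one_ne_zero
    (convex_closedBall _ _) (isCompact_closedBall _ _)
  have hss := Set.Ioo_subset_Icc_self (a := -S) (b := S)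
  refine ODE_solution_unique_of_mem_Ioo (v := fun _ => v) (s := fun _ => Metric.closedBall (0:E) (max C1 C2))
    (K := K) (a := -S) (b := S) (t₀ := 0)
    (fun _ _ => hK) ⟨by linarith, hS0⟩ (fun s hs => ⟨hf s (hsub (hss hs)), ?_⟩)
    (fun s hs => ⟨hg s (hsub (hss hs)), ?_⟩) h0 (abs_lt.1 hS1)
  · simpa using Or.inl (hC1 s (hss hs))
  · simpa using Or.inr (hC2 s (hss hs))

theorem ode_unique {E : Type*} [NormedAddCommGroup E] [NormedSpace ℝ E]
    [FiniteDimensional ℝ E] (v : E → E) (hv : ContDiff ℝ 1 v) (f g : ℝ → E)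
    (hf : ∀ t, HasDerivAt f (v (f t)) t)
    (hg : ∀ t, HasDerivAt g (v (g t)) t)
    (h0 : f 0 = g 0) : f = g := by
  funext t
  exact ode_unique_Ioo v hv (|t|+1) f g (fun t _ => hf t) (fun t _ => hg t) h0 t
    (abs_lt.1 (by linarith))

theorem ode_glue {E : Type*} [NormedAddCommGroup E] [NormedSpace ℝ E]
    [FiniteDimensional ℝ E] (v : E → E) (hv : ContDiff ℝ 1 v) (z0 : E)
    (h : ∀ T : ℝ, 0 < T → ∃ f : ℝ → E, f 0 = z0 ∧ ∀ t ∈ Set.Ioo (-T) T, HasDerivAt f (v (f t)) t) :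
    ∃ f : ℝ → E, f 0 = z0 ∧ ∀ t, HasDerivAt f (v (f t)) t := by
  have h' : ∀ T : ℝ, ∃ f : ℝ → E, f 0 = z0 ∧ ∀ t ∈ Set.Ioo (-T) T, HasDerivAt f (v (f t)) t := by
    intro T
    obtain ⟨f, hf0, hf⟩ := h (|T|+1) (by positivity)
    exact ⟨f, hf0, fun t ht => hf t ⟨by linarith [ht.1, le_abs_self T], by linarith [ht.2, le_abs_self T]⟩⟩
  choose F hF0 hF using h'
  refine ⟨fun t => F (|t|+1) t, by simp [hF0], fun t => ?_⟩
  have key : ∀ S, |t| + 1 ≤ S → ∀ s ∈ Set.Ioo (-(|t|+1)) (|t|+1), F (|t|+1) s = F S s := by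
    intro S hS
    exact ode_unique_Ioo v hv _ _ _ (hF _)
      (fun s hs => hF S s ⟨by linarith [hs.1], by linarith [hs.2]⟩) (by rw [hF0, hF0])
  have h1 := hF (|t|+2) t (abs_lt.1 (by linarith))
  have ht : F (|t|+1) t = F (|t|+2) t := key _ (by linarith) t (abs_lt.1 (by linarith))
  simp only [ht]
  refine h1.congr_of_eventuallyEq ?_
  have : ∀ᶠ s in nhds t, |s| < |t| + 1 :=
    continuous_abs.continuousAt.eventually_lt_const (by linarith)
  filter_upwards [this] with s hs
  exact ode_unique_Ioo v hv (|s|+1) _ _ (hF _)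
      (fun r hr => hF _ r ⟨by linarith [hr.1], by linarith [hr.2]⟩) (by rw [hF0, hF0]) s (abs_lt.1 (by linarith))

/-- Second order uniqueness -/
theorem ode2_unique {E : Type*} [NormedAddCommGroup E] [NormedSpace ℝ E]
    [FiniteDimensional ℝ E] (g : E → E) (hg : ContDiff ℝ 1 g) (x y x' y' : ℝ → E)
    (hx : ∀ t, HasDerivAt x (y t) t) (hy : ∀ t, HasDerivAt y (-g (x t)) t)
    (hx' : ∀ t, HasDerivAt x' (y' t) t) (hy' : ∀ t, HasDerivAt y' (-g (x' t)) t)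
    (h0 : x 0 = x' 0) (h1 : y 0 = y' 0) : x = x' := by
  have := ode_unique (E := E × E) (fun z => (z.2, -g z.1)) (by fun_prop)
    (fun t => (x t, y t)) (fun t => (x' t, y' t))
    (fun t => (hx t).prodMk (hy t)) (fun t => (hx' t).prodMk (hy' t)) (by simp [h0, h1])
  funext t
  exact congrArg Prod.fst (congrFun this t)

/-- Global existence for Hamiltonian systems with nonneg potential -/
theorem ode_hamilton {X : Type*} [NormedAddCommGroup X] [InnerProductSpace ℝ X]
    [FiniteDimensional ℝ X] (g : X → X) (hg : ContDiff ℝ 1 g) (V : X → ℝ)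
    (hV : ∀ x, 0 ≤ V x)
    (hVd : ∀ (x : ℝ → X) (y : X) (t : ℝ), HasDerivAt x y t →
      HasDerivAt (fun s => V (x s)) (inner ℝ (g (x t)) y) t) (x0 y0 : X) :
    ∃ x y : ℝ → X, x 0 = x0 ∧ y 0 = y0 ∧ (∀ t, HasDerivAt x (y t) t) ∧
      ∀ t, HasDerivAt y (-g (x t)) t := by
  let v : X × X → X × X := fun z => (z.2, -g z.1)
  have hv : ContDiff ℝ 1 v := by fun_prop
  suffices h : ∃ f : ℝ → X × X, f 0 = (x0, y0) ∧ ∀ t, HasDerivAt f (v (f t)) t by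
    obtain ⟨f, hf0, hf⟩ := h
    exact ⟨fun t => (f t).1, fun t => (f t).2, by simp [hf0], by simp [hf0],
      fun t => (hf t).fst, fun t => (hf t).snd⟩
  refine ode_glue v hv _ fun T hT => ?_
  set H := ‖y0‖ ^ 2 / 2 + V x0 with hH
  have hH0 : 0 ≤ H := by have := hV x0; positivity
  set R := ‖x0‖ + Real.sqrt (2 * H) * T + Real.sqrt (2 * H) + 1 with hR
  have hR0 : 0 < R := by positivity
  let χ : ContDiffBump (0 : X × X) := ⟨R, R + 1, hR0, by linarith⟩
  let w : X × X → X × X := fun z => χ z • v z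
  have hw : ContDiff ℝ 1 w := χ.contDiff.smul hv
  have hwc : HasCompactSupport w := χ.hasCompactSupport.smul_right
  obtain ⟨K, hK⟩ := hw.lipschitzWith_of_hasCompactSupport hwc one_ne_zero
  obtain ⟨C, hC⟩ := hwc.exists_bound_of_continuous hw.continuous
  have hC0 : 0 ≤ C := (norm_nonneg _).trans (hC 0)
  have hPL : IsPicardLindelof (fun _ => w) (tmin := -T) (tmax := T)
      ⟨0, by constructor <;> linarith⟩ (x0, y0) (⟨C, hC0⟩ * ⟨T, hT.le⟩) 0 ⟨C, hC0⟩ K := by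
    refine ⟨fun _ _ => hK.lipschitzOnWith, fun _ _ => continuousOn_const, fun _ _ z _ => hC z, ?_⟩
    simp only [sub_zero, zero_sub, neg_neg, max_self, NNReal.coe_zero]
    exact le_rfl
  obtain ⟨f, hf0, hf⟩ := hPL.exists_eq_forall_mem_Icc_hasDerivWithinAt₀
  have hf0 : f 0 = (x0, y0) := hf0
  have hfd : ∀ t ∈ Set.Ioo (-T) T, HasDerivAt f (w (f t)) t := fun t ht =>
    (hf t (Set.Ioo_subset_Icc_self ht)).hasDerivAt (Icc_mem_nhds ht.1 ht.2)
  refine ⟨f, hf0, fun t ht => ?_⟩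
  have h1 : ∀ t ∈ Set.Ioo (-T) T, HasDerivAt (fun s => (f s).1) (χ (f t) • (f t).2) t :=
    fun t ht => (hfd t ht).fst
  have h2 : ∀ t ∈ Set.Ioo (-T) T, HasDerivAt (fun s => (f s).2) (χ (f t) • -g (f t).1) t :=
    fun t ht => (hfd t ht).snd
  have h00 : (0:ℝ) ∈ Set.Ioo (-T) T := by constructor <;> linarith
  have hen : ∀ t ∈ Set.Ioo (-T) T, HasDerivAt (fun s => ‖(f s).2‖ ^ 2 / 2 + V (f s).1) 0 t := by
    intro t ht
    have e1 := ((h2 t ht).norm_sq.div_const 2).add (hVd _ _ t (h1 t ht))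
    refine HasDerivAt.congr_deriv e1 ?_
    rw [inner_smul_right, inner_smul_right, inner_neg_right, real_inner_comm (g (f t).1)]
    ring
  have hen2 : ∀ t ∈ Set.Ioo (-T) T, ‖(f t).2‖ ^ 2 / 2 + V (f t).1 = H := by
    intro t ht
    have := isOpen_Ioo.is_const_of_deriv_eq_zero isPreconnected_Ioo
      (fun s hs => (hen s hs).differentiableAt.differentiableWithinAt)
      (fun s hs => (hen s hs).deriv) ht h00
    simpa [hf0] using this
  have hy : ∀ t ∈ Set.Ioo (-T) T, ‖(f t).2‖ ≤ Real.sqrt (2 * H) := by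
    intro t ht
    apply Real.le_sqrt_of_sq_le
    linarith [hen2 t ht, hV (f t).1]
  have hx : ‖(f t).1 - (f 0).1‖ ≤ Real.sqrt (2 * H) * ‖t - 0‖ := by
    refine (convex_Ioo (-T) T).norm_image_sub_le_of_norm_hasDerivWithin_le
      (fun s hs => (h1 s hs).hasDerivWithinAt) (fun s hs => ?_) h00 ht
    rw [norm_smul, Real.norm_of_nonneg χ.nonneg]
    calc χ (f s) * ‖(f s).2‖ ≤ 1 * ‖(f s).2‖ := by gcongr; exact χ.le_one
      _ ≤ _ := by simpa using hy s hs
  have hmem : f t ∈ Metric.closedBall (0 : X × X) χ.rIn := by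
    have e1 : ‖t - 0‖ ≤ T := by simpa using (abs_lt.2 ht).le
    have e2 : ‖(f t).1‖ ≤ ‖x0‖ + Real.sqrt (2 * H) * T := by
      have := norm_le_norm_add_norm_sub' (f t).1 (f 0).1
      have e3 : Real.sqrt (2 * H) * ‖t - 0‖ ≤ Real.sqrt (2 * H) * T := by gcongr
      rw [hf0] at this hx
      linarith
    have e4 := hy t ht
    have e5 := Real.sqrt_nonneg (2 * H)
    have e6 : 0 ≤ Real.sqrt (2 * H) * T := by positivity
    rw [mem_closedBall_zero_iff, Prod.norm_def]
    have e7 := norm_nonneg x0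
    exact max_le (by change _ ≤ R; linarith) (by change _ ≤ R; linarith)
  have := hfd t ht
  simpa [w, χ.one_of_mem_closedBall hmem] using this
theorem mem_latticeBall (N : ℕ) (n : Fin 3 → ℤ) : n ∈ latticeBall N ↔ nsqZ n ≤ (N : ℤ)^2 := by
  unfold latticeBall
  rw [Finset.mem_filter, and_iff_right_iff_imp]
  intro h
  rw [Finset.mem_Icc]
  have key : ∀ i, (n i)^2 ≤ (N:ℤ)^2 := fun i =>
    (Finset.single_le_sum (f := fun i => (n i)^2) (fun i _ => sq_nonneg (n i)) (Finset.mem_univ i)).trans h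
  exact ⟨fun i => (abs_le.1 (abs_le_of_sq_le_sq (key i) (by positivity))).1,
    fun i => (abs_le.1 (abs_le_of_sq_le_sq (key i) (by positivity))).2⟩

theorem nsqZ_neg (n : Fin 3 → ℤ) : nsqZ (-n) = nsqZ n := by simp [nsqZ]

theorem neg_mem_latticeBall (N : ℕ) (n : Fin 3 → ℤ) : -n ∈ latticeBall N ↔ n ∈ latticeBall N := by
  simp only [mem_latticeBall, nsqZ_neg]

theorem sum_latticeBall_neg (N : ℕ) (f : (Fin 3 → ℤ) → ℂ) :
    ∑ n ∈ latticeBall N, f (-n) = ∑ n ∈ latticeBall N, f n :=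
  Finset.sum_equiv (Equiv.neg _) (fun n => by simp [neg_mem_latticeBall]) (fun n _ => by simp)

theorem cubicTrunc_eq (N : ℕ) (a : (Fin 3 → ℤ) → ℂ) (n : Fin 3 → ℤ) (hn : n ∈ latticeBall N) :
    cubicTrunc N a n = ∑ m ∈ latticeBall N, ∑ k ∈ latticeBall N, ∑ l ∈ latticeBall N,
      if m + k + l = n then a m * a k * a l else 0 := by
  unfold cubicTrunc
  rw [if_pos ((mem_latticeBall N n).1 hn)]
  refine Finset.sum_congr rfl fun m _ => Finset.sum_congr rfl fun k _ => ?_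
  have : ∀ l, (m + k + l = n) ↔ (n - m - k = l) := fun l =>
    ⟨fun h => by rw [← h]; abel, fun h => by rw [← h]; abel⟩
  simp only [this, Finset.sum_ite_eq, mem_latticeBall]

theorem cubicTrunc_congr (N : ℕ) (a b : (Fin 3 → ℤ) → ℂ) (h : ∀ n ∈ latticeBall N, a n = b n)
    (n : Fin 3 → ℤ) : cubicTrunc N a n = cubicTrunc N b n := by
  by_cases hn : n ∈ latticeBall N
  · rw [cubicTrunc_eq N a n hn, cubicTrunc_eq N b n hn]
    refine Finset.sum_congr rfl fun m hm => Finset.sum_congr rfl fun k hk =>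
      Finset.sum_congr rfl fun l hl => ?_
    rw [h m hm, h k hk, h l hl]
  · rw [mem_latticeBall] at hn
    simp [cubicTrunc, hn]

theorem cubicTrunc_out (N : ℕ) (a : (Fin 3 → ℤ) → ℂ) (n : Fin 3 → ℤ) (hn : n ∉ latticeBall N) :
    cubicTrunc N a n = 0 := by
  rw [mem_latticeBall] at hn
  simp [cubicTrunc, hn]

theorem cubicTrunc_herm (N : ℕ) (a : (Fin 3 → ℤ) → ℂ) (ha : HermSymm a) :
    HermSymm (cubicTrunc N a) := by
  intro n
  by_cases hn : n ∈ latticeBall N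
  · rw [cubicTrunc_eq N a n hn, cubicTrunc_eq N a (-n) ((neg_mem_latticeBall N n).2 hn)]
    rw [← sum_latticeBall_neg, map_sum]
    refine Finset.sum_congr rfl fun m hm => ?_
    rw [← sum_latticeBall_neg, map_sum]
    refine Finset.sum_congr rfl fun k hk => ?_
    rw [← sum_latticeBall_neg, map_sum]
    refine Finset.sum_congr rfl fun l hl => ?_
    have : -m + -k + -l = -n ↔ m + k + l = n := by
      rw [← neg_inj (a := m + k + l)]; simp only [neg_add]
    simp only [this, ha m, ha k, ha l]
    split_ifs <;> simp
  · rw [cubicTrunc_out N a n hn, cubicTrunc_out N a (-n) (by rwa [neg_mem_latticeBall])]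
    simp

/-- the quartic form -/
def quart (N : ℕ) (a b c d : (Fin 3 → ℤ) → ℂ) : ℂ :=
  ∑ m ∈ latticeBall N, ∑ k ∈ latticeBall N, ∑ l ∈ latticeBall N, ∑ j ∈ latticeBall N,
    if m + k + l + j = 0 then a m * b k * c l * d j else 0

theorem quart_swap1 (N : ℕ) (a b c d : (Fin 3 → ℤ) → ℂ) : quart N a b c d = quart N b a c d := by
  unfold quart
  rw [Finset.sum_comm]
  refine Finset.sum_congr rfl fun m _ => Finset.sum_congr rfl fun k _ =>
    Finset.sum_congr rfl fun l _ => Finset.sum_congr rfl fun j _ => ?_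
  rw [add_comm k m, mul_comm (a k)]

theorem quart_swap2 (N : ℕ) (a b c d : (Fin 3 → ℤ) → ℂ) : quart N a b c d = quart N a c b d := by
  unfold quart
  refine Finset.sum_congr rfl fun m _ => ?_
  rw [Finset.sum_comm]
  refine Finset.sum_congr rfl fun k _ =>
    Finset.sum_congr rfl fun l _ => Finset.sum_congr rfl fun j _ => ?_
  rw [add_right_comm m l k, mul_right_comm (a m)]

theorem quart_swap3 (N : ℕ) (a b c d : (Fin 3 → ℤ) → ℂ) : quart N a b c d = quart N a b d c := by
  unfold quart
  refine Finset.sum_congr rfl fun m _ => Finset.sum_congr rfl fun k _ => ?_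
  rw [Finset.sum_comm]
  refine Finset.sum_congr rfl fun l _ => Finset.sum_congr rfl fun j _ => ?_
  rw [add_right_comm (m + k) j l, mul_right_comm (a m * b k)]

theorem quart_eq (N : ℕ) (a b : (Fin 3 → ℤ) → ℂ) :
    quart N a a a b = ∑ j ∈ latticeBall N, cubicTrunc N a (-j) * b j := by
  have h1 : ∀ j ∈ latticeBall N, cubicTrunc N a (-j) * b j =
    ∑ m ∈ latticeBall N, ∑ k ∈ latticeBall N, ∑ l ∈ latticeBall N,
      if m + k + l + j = 0 then a m * a k * a l * b j else 0 := by
    intro j hj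
    rw [cubicTrunc_eq N a (-j) ((neg_mem_latticeBall N j).2 hj), Finset.sum_mul]
    refine Finset.sum_congr rfl fun m _ => ?_
    rw [Finset.sum_mul]
    refine Finset.sum_congr rfl fun k _ => ?_
    rw [Finset.sum_mul]
    refine Finset.sum_congr rfl fun l _ => ?_
    simp only [eq_neg_iff_add_eq_zero, ite_mul, zero_mul]
  rw [Finset.sum_congr rfl h1]
  unfold quart
  symm
  rw [Finset.sum_comm]
  refine Finset.sum_congr rfl fun m _ => ?_
  rw [Finset.sum_comm]
  refine Finset.sum_congr rfl fun k _ => ?_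
  exact Finset.sum_comm

theorem quart_deriv (N : ℕ) (a : ℝ → (Fin 3 → ℤ) → ℂ) (b : (Fin 3 → ℤ) → ℂ) (t : ℝ)
    (h : ∀ n ∈ latticeBall N, HasDerivAt (fun s => a s n) (b n) t) :
    HasDerivAt (fun s => quart N (a s) (a s) (a s) (a s)) (4 * quart N (a t) (a t) (a t) b) t := by
  have e : 4 * quart N (a t) (a t) (a t) b = quart N b (a t) (a t) (a t) +
      quart N (a t) b (a t) (a t) + quart N (a t) (a t) b (a t) + quart N (a t) (a t) (a t) b := by
    rw [quart_swap1 N b, quart_swap2 N (a t) b, quart_swap3 N (a t) (a t) b]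
    ring
  rw [e]
  unfold quart
  simp only [← Finset.sum_add_distrib]
  refine HasDerivAt.fun_sum fun m hm => HasDerivAt.fun_sum fun k hk =>
    HasDerivAt.fun_sum fun l hl => HasDerivAt.fun_sum fun j hj => ?_
  split_ifs
  · refine HasDerivAt.congr_deriv ((((h m hm).mul (h k hk)).mul (h l hl)).mul (h j hj)) ?_
    simp only [Pi.mul_apply]
    ring
  · simpa using hasDerivAt_const t (0:ℂ)

theorem quart_nonneg (N : ℕ) (a : (Fin 3 → ℤ) → ℂ) (ha : HermSymm a) :
    0 ≤ (quart N a a a a).re := by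
  let A : (Fin 3 → ℤ) → ℂ := fun s =>
    ∑ l ∈ latticeBall N, ∑ j ∈ latticeBall N, if l + j = s then a l * a j else 0
  have hA : ∀ s, A (-s) = (starRingEnd ℂ) (A s) := by
    intro s
    simp only [A]
    rw [← sum_latticeBall_neg, map_sum]
    refine Finset.sum_congr rfl fun m hm => ?_
    rw [← sum_latticeBall_neg, map_sum]
    refine Finset.sum_congr rfl fun k hk => ?_
    have : -m + -k = -s ↔ m + k = s := by
      rw [← neg_inj (a := m + k)]; simp only [neg_add]
    simp only [this, ha m, ha k]
    split_ifs <;> simp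
  let S : Finset (Fin 3 → ℤ) := (latticeBall N ×ˢ latticeBall N).image (fun p => p.1 + p.2)
  have h1 : quart N a a a a = ∑ m ∈ latticeBall N, ∑ k ∈ latticeBall N, ∑ s ∈ S,
      if m + k = s then a m * a k * A (-s) else 0 := by
    unfold quart
    refine Finset.sum_congr rfl fun m hm => Finset.sum_congr rfl fun k hk => ?_
    have hmem : m + k ∈ S := Finset.mem_image.2 ⟨(m, k), Finset.mk_mem_product hm hk, rfl⟩
    rw [Finset.sum_ite_eq, if_pos hmem]
    simp only [A, Finset.mul_sum]
    refine Finset.sum_congr rfl fun l _ => Finset.sum_congr rfl fun j _ => ?_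
    have : m + k + l + j = 0 ↔ l + j = -(m + k) := by
      rw [eq_neg_iff_add_eq_zero]
      have : m + k + l + j = l + j + (m + k) := by abel
      rw [this]
    simp only [this, mul_ite, mul_zero, mul_assoc]
  have h2 : quart N a a a a = ∑ s ∈ S, A s * (starRingEnd ℂ) (A s) := by
    rw [h1]
    have : ∀ m ∈ latticeBall N, (∑ k ∈ latticeBall N, ∑ s ∈ S,
      if m + k = s then a m * a k * A (-s) else 0) = ∑ s ∈ S, ∑ k ∈ latticeBall N, 
      if m + k = s then a m * a k * A (-s) else 0 := fun m _ => Finset.sum_comm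
    rw [Finset.sum_congr rfl this, Finset.sum_comm]
    refine Finset.sum_congr rfl fun s _ => ?_
    rw [← hA]
    conv_rhs => rw [show A s = ∑ l ∈ latticeBall N, ∑ j ∈ latticeBall N, if l + j = s then a l * a j else 0 from rfl]
    simp only [Finset.sum_mul, ite_mul, zero_mul]
  rw [h2, Complex.re_sum]
  refine Finset.sum_nonneg fun s _ => ?_
  rw [Complex.mul_conj]
  exact_mod_cast Complex.normSq_nonneg _
/-- extension by zero of low modes -/
def extLow (N : ℕ) (x : EuclideanSpace ℂ (latticeBall N)) (n : Fin 3 → ℤ) : ℂ :=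
  if h : n ∈ latticeBall N then x ⟨n, h⟩ else 0

theorem extLow_mem (N : ℕ) (x : EuclideanSpace ℂ (latticeBall N)) (n : latticeBall N) :
    extLow N x n = x n := by simp [extLow]

/-- evaluation as a continuous linear map -/
def extL (N : ℕ) (n : Fin 3 → ℤ) : EuclideanSpace ℂ (latticeBall N) →L[ℝ] ℂ :=
  if h : n ∈ latticeBall N then PiLp.proj 2 (fun _ : latticeBall N => ℂ) (⟨n, h⟩ : latticeBall N) else 0

theorem extL_apply (N : ℕ) (n : Fin 3 → ℤ) (x : EuclideanSpace ℂ (latticeBall N)) :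
    extL N n x = extLow N x n := by
  unfold extL extLow
  split_ifs <;> simp

/-- the low mode vector field -/
def gLow (N : ℕ) (x : EuclideanSpace ℂ (latticeBall N)) : EuclideanSpace ℂ (latticeBall N) :=
  WithLp.toLp 2 (fun n : latticeBall N => ((nsqZ n : ℝ) : ℂ) * x n + cubicTrunc N (extLow N x) n)

theorem gLow_contDiff (N : ℕ) : ContDiff ℝ 1 (gLow N) := by
  have h0 : ∀ n, ContDiff ℝ 1 (fun x => extLow N x n) := by
    intro n
    simp only [← extL_apply]
    exact (extL N n).contDiff
  rw [contDiff_piLp]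
  intro n
  have h1 : (fun x => gLow N x n) = fun x =>
      ((nsqZ n : ℝ) : ℂ) * extLow N x n + cubicTrunc N (extLow N x) n := by
    funext x
    simp [gLow, extLow_mem]
  rw [h1]
  refine (contDiff_const.mul (h0 _)).add ?_
  simp only [cubicTrunc_eq N _ _ n.2]
  refine ContDiff.sum fun m _ => ContDiff.sum fun k _ => ContDiff.sum fun l _ => ?_
  split_ifs
  · exact ((h0 _).mul (h0 _)).mul (h0 _)
  · exact contDiff_const

/-- Hermitian subspace -/
def hermSub (N : ℕ) : Submodule ℝ (EuclideanSpace ℂ (latticeBall N)) where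
  carrier := {x | HermSymm (extLow N x)}
  add_mem' := by
    intro x y hx hy n
    have h1 := hx n
    have h2 := hy n
    simp only [← extL_apply, map_add] at *
    rw [h1, h2]
  zero_mem' := by
    intro n
    simp only [← extL_apply, map_zero]
  smul_mem' := by
    intro c x hx n
    have h1 := hx n
    simp only [← extL_apply, map_smul] at *
    rw [h1]
    simp

theorem extLow_toLp (N : ℕ) (f : (Fin 3 → ℤ) → ℂ) (n : Fin 3 → ℤ) (hn : n ∈ latticeBall N) :
    extLow N (WithLp.toLp 2 (fun m : latticeBall N => f m)) n = f n := by
  simp [extLow, hn]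

theorem toLp_herm (N : ℕ) (f : (Fin 3 → ℤ) → ℂ) (hf : HermSymm f) :
    WithLp.toLp 2 (fun m : latticeBall N => f m) ∈ hermSub N := by
  intro n
  by_cases hn : n ∈ latticeBall N
  · rw [extLow_toLp N f n hn, extLow_toLp N f (-n) ((neg_mem_latticeBall N n).2 hn)]
    exact hf n
  · have hn' : -n ∉ latticeBall N := by rwa [neg_mem_latticeBall]
    simp [extLow, hn, hn']

theorem gLow_herm (N : ℕ) (x : EuclideanSpace ℂ (latticeBall N)) (hx : x ∈ hermSub N) :
    gLow N x ∈ hermSub N := by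
  have hx' : HermSymm (extLow N x) := hx
  have : gLow N x = WithLp.toLp 2 (fun m : latticeBall N =>
      (fun n => ((nsqZ n : ℝ) : ℂ) * extLow N x n + cubicTrunc N (extLow N x) n) m) := by
    simp [gLow, extLow_mem]
  rw [this]
  refine toLp_herm N (fun n => ((nsqZ n : ℝ) : ℂ) * extLow N x n + cubicTrunc N (extLow N x) n) ?_
  intro n
  simp only [nsqZ_neg, hx' n, cubicTrunc_herm N _ hx' n, map_add, map_mul, Complex.conj_ofReal]

/-- potential -/
def potLow (N : ℕ) (x : EuclideanSpace ℂ (latticeBall N)) : ℝ :=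
  (∑ n ∈ latticeBall N, (nsqZ n : ℝ) * (‖extLow N x n‖ ^ 2 / 2)) +
    (quart N (extLow N x) (extLow N x) (extLow N x) (extLow N x)).re / 4

theorem nsqZ_nonneg (n : Fin 3 → ℤ) : (0:ℝ) ≤ nsqZ n := by
  have : 0 ≤ nsqZ n := Finset.sum_nonneg fun i _ => sq_nonneg _
  exact_mod_cast this

theorem low_exist (N : ℕ) (a₀ b₀ : (Fin 3 → ℤ) → ℂ) (ha : HermSymm a₀) (hb : HermSymm b₀) :
    ∃ a b : ℝ → (Fin 3 → ℤ) → ℂ, (∀ n ∈ latticeBall N, a 0 n = a₀ n ∧ b 0 n = b₀ n) ∧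
      (∀ t, HermSymm (a t)) ∧
      ∀ t, ∀ n ∈ latticeBall N, HasDerivAt (fun s => a s n) (b t n) t ∧
        HasDerivAt (fun s => b s n) (-((nsqZ n : ℝ) : ℂ) * a t n - cubicTrunc N (a t) n) t := by
  have hgm : ∀ x : hermSub N, (((hermSub N).orthogonalProjectionOnto (gLow N x) : hermSub N) :
      EuclideanSpace ℂ (latticeBall N)) = gLow N x := fun x =>
    congrArg Subtype.val ((hermSub N).orthogonalProjectionOnto_mem_subspace_eq_self ⟨gLow N x, gLow_herm N x x.2⟩)
  have hgc : ContDiff ℝ 1 (fun x : hermSub N => (hermSub N).orthogonalProjectionOnto (gLow N x)) :=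
    ((hermSub N).orthogonalProjectionOnto.contDiff.comp
      ((gLow_contDiff N).comp (hermSub N).subtypeL.contDiff))
  obtain ⟨x, y, hx0, hy0, hx, hy⟩ := ode_hamilton (X := hermSub N)
    (fun x => (hermSub N).orthogonalProjectionOnto (gLow N x))
    hgc
    (fun x => potLow N x)
    (fun x => add_nonneg (Finset.sum_nonneg fun n _ => mul_nonneg (nsqZ_nonneg n) (by positivity))
      (div_nonneg (quart_nonneg N _ x.2) (by norm_num)))
    (by
      intro x y t hxy
      have hc : ∀ n, HasDerivAt (fun s => extLow N (x s) n) (extLow N y n) t := by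
        intro n
        have := ((extL N n).comp (hermSub N).subtypeL).hasFDerivAt.comp_hasDerivAt t hxy
        simpa [Function.comp_def, extL_apply] using this
      have hq := quart_deriv N (fun s => extLow N (x s)) (extLow N y) t (fun n _ => hc n)
      have hq' := (Complex.reCLM.hasFDerivAt.comp_hasDerivAt t hq).div_const 4
      have hs := HasDerivAt.fun_sum (u := latticeBall N) fun n _ =>
        ((hc n).norm_sq.div_const 2).const_mul (nsqZ n : ℝ)
      refine HasDerivAt.congr_deriv (hs.add hq') ?_
      rw [Submodule.coe_inner, hgm, quart_eq, PiLp.inner_apply]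
      have e1 : ∀ n : latticeBall N, inner ℝ ((gLow N (x t)) n) ((y : EuclideanSpace ℂ (latticeBall N)) n) =
          (fun m => inner ℝ (((nsqZ m : ℝ) : ℂ) * extLow N (x t) m + cubicTrunc N (extLow N (x t)) m)
            (extLow N y m)) (n : Fin 3 → ℤ) := by
        intro n
        simp [gLow, extLow_mem]
      rw [Finset.sum_congr rfl fun n _ => e1 n, Finset.sum_coe_sort (latticeBall N)
        (fun m => inner ℝ (((nsqZ m : ℝ) : ℂ) * extLow N (x t) m + cubicTrunc N (extLow N (x t)) m)
            (extLow N y m))]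
      have hh : HermSymm (extLow N (x t)) := (x t).2
      simp only [cubicTrunc_herm N _ hh _]
      simp only [inner_add_left, Finset.sum_add_distrib]
      congr 1
      · refine Finset.sum_congr rfl fun n _ => ?_
        simp [Complex.inner]
        ring
      · simp [Complex.inner]
        exact Finset.sum_congr rfl fun n _ => by ring)
    ⟨_, toLp_herm N a₀ ha⟩ ⟨_, toLp_herm N b₀ hb⟩
  have hc : ∀ n t, HasDerivAt (fun s => extLow N (x s) n) (extLow N (y t) n) t := by
    intro n t
    have := ((extL N n).comp (hermSub N).subtypeL).hasFDerivAt.comp_hasDerivAt t (hx t)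
    simpa [Function.comp_def, extL_apply] using this
  refine ⟨fun t => extLow N (x t), fun t => extLow N (y t), ?_, fun t => (x t).2, ?_⟩
  · intro n hn
    simp only [hx0, hy0]
    exact ⟨extLow_toLp N a₀ n hn, extLow_toLp N b₀ n hn⟩
  · intro t n hn
    refine ⟨hc n t, ?_⟩
    have := ((extL N n).comp (hermSub N).subtypeL).hasFDerivAt.comp_hasDerivAt t (hy t)
    simp only [Function.comp_def, ContinuousLinearMap.comp_apply, Submodule.subtypeL_apply, extL_apply] at this
    refine this.congr_deriv ?_
    rw [← extL_apply, Submodule.coe_neg, hgm, map_neg, extL_apply]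
    simp [gLow, extLow, hn]
    ring

theorem low_unique (N : ℕ) (a b a' b' : ℝ → (Fin 3 → ℤ) → ℂ)
    (h0 : ∀ n, a 0 n = a' 0 n) (h1 : ∀ n, b 0 n = b' 0 n)
    (h : ∀ t, ∀ n ∈ latticeBall N, HasDerivAt (fun s => a s n) (b t n) t ∧
        HasDerivAt (fun s => b s n) (-((nsqZ n : ℝ) : ℂ) * a t n - cubicTrunc N (a t) n) t)
    (h' : ∀ t, ∀ n ∈ latticeBall N, HasDerivAt (fun s => a' s n) (b' t n) t ∧
        HasDerivAt (fun s => b' s n) (-((nsqZ n : ℝ) : ℂ) * a' t n - cubicTrunc N (a' t) n) t) :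
    ∀ t, ∀ n ∈ latticeBall N, a t n = a' t n := by
  let P : (ℝ → (Fin 3 → ℤ) → ℂ) → ℝ → EuclideanSpace ℂ (latticeBall N) :=
    fun a t => WithLp.toLp 2 (fun m : latticeBall N => a t m)
  have hP : ∀ (f : ℝ → (Fin 3 → ℤ) → ℂ) (f' : EuclideanSpace ℂ (latticeBall N)) (t : ℝ),
      (∀ n : latticeBall N, HasDerivAt (fun s => f s n) (f' n) t) → HasDerivAt (P f) f' t := by
    intro f f' t hf
    have h2 : HasDerivAt (fun s => (fun n : latticeBall N => f s n)) (WithLp.ofLp f') t :=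
      hasDerivAt_pi.2 hf
    exact ((PiLp.continuousLinearEquiv 2 ℝ (fun _ : latticeBall N => ℂ)).symm.toContinuousLinearMap).hasFDerivAt.comp_hasDerivAt t h2
  have hG : ∀ (a : ℝ → (Fin 3 → ℤ) → ℂ) t (n : latticeBall N), (-gLow N (P a t)) n =
      -((nsqZ n : ℝ) : ℂ) * a t n - cubicTrunc N (a t) n := by
    intro a t n
    have : cubicTrunc N (extLow N (P a t)) n = cubicTrunc N (a t) n :=
      cubicTrunc_congr N _ _ (fun n hn => extLow_toLp N (a t) n hn) n
    simp only [gLow, PiLp.neg_apply, this, P]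
    ring
  have key := ode2_unique (gLow N) (gLow_contDiff N) (P a) (P b) (P a') (P b')
    (fun t => hP _ _ t fun n => (h t n n.2).1)
    (fun t => hP _ _ t fun n => by rw [hG]; exact (h t n n.2).2)
    (fun t => hP _ _ t fun n => (h' t n n.2).1)
    (fun t => hP _ _ t fun n => by rw [hG]; exact (h' t n n.2).2)
    (by simp [P, h0]) (by simp [P, h1])
  intro t n hn
  have := congrArg (fun z => extLow N z n) (congrFun key t)
  simpa only [P, extLow_toLp N _ n hn] using this
theorem hterm (w : ℝ) (hw : 0 ≤ w) (z : ℂ) :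
    ENNReal.ofReal w * (‖z‖₊ : ℝ≥0∞)^2 = ENNReal.ofReal (w * ‖z‖^2) := by
  rw [ENNReal.ofReal_mul hw, ENNReal.ofReal_pow (norm_nonneg z), ofReal_norm_eq_enorm]
  rfl

theorem hNormSq_le (σ : ℝ) (N : ℕ) (f C : (Fin 3 → ℤ) → ℝ≥0∞) (a : (Fin 3 → ℤ) → ℂ)
    (h1 : ∀ n ∉ latticeBall N, ENNReal.ofReal ((1 + (nsqZ n : ℝ)) ^ σ) * (‖a n‖₊ : ℝ≥0∞)^2 ≤ f n)
    (h2 : ∀ n ∈ latticeBall N, ENNReal.ofReal ((1 + (nsqZ n : ℝ)) ^ σ) * (‖a n‖₊ : ℝ≥0∞)^2 ≤ C n) :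
    hNormSq σ a ≤ ∑' n, f n + ∑ n ∈ latticeBall N, C n := by
  have h3 : ∑ n ∈ latticeBall N, C n = ∑' n, if n ∈ latticeBall N then C n else 0 := by
    rw [tsum_eq_sum (s := latticeBall N) (fun n hn => by simp [hn])]
    exact Finset.sum_congr rfl fun n hn => by simp [hn]
  rw [h3, ← ENNReal.tsum_add]
  refine ENNReal.tsum_le_tsum fun n => ?_
  by_cases hn : n ∈ latticeBall N
  · simpa [hn] using (h2 n hn).trans le_add_self
  · simpa [hn] using h1 n hn

theorem hi_bound1 (r A B : ℝ) (hr : 1 ≤ r) : (1 + r^2) * (A + B / r)^2 ≤ 4 * ((1 + r^2) * A^2 + B^2) := by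
  have hr0 : 0 < r := by linarith
  set D := B / r with hD
  have hB : B = D * r := by rw [hD]; field_simp
  rw [hB]
  have h1 : (A + D)^2 ≤ 2 * A^2 + 2 * D^2 := by nlinarith [sq_nonneg (A - D)]
  have h2 : 1 ≤ r^2 := by nlinarith
  have h3 : 0 ≤ D^2 := sq_nonneg D
  have h4 : 0 ≤ A^2 := sq_nonneg A
  calc (1 + r^2) * (A + D)^2 ≤ (1 + r^2) * (2 * A^2 + 2 * D^2) := by gcongr
    _ ≤ _ := by nlinarith [mul_nonneg (by linarith : 0 ≤ r^2 - 1) h3, mul_nonneg (sq_nonneg r) h4]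

theorem hi_bound2 (r A B : ℝ) : (r * A + B)^2 ≤ 4 * ((1 + r^2) * A^2 + B^2) := by
  nlinarith [sq_nonneg (r * A - B), sq_nonneg A, sq_nonneg B, sq_nonneg (r * A)]

/-- explicit high mode -/
def hiA (r : ℝ) (α β : ℂ) (t : ℝ) : ℂ := Real.cos (r * t) • α + (Real.sin (r * t) / r) • β
/-- its derivative -/
def hiB (r : ℝ) (α β : ℂ) (t : ℝ) : ℂ := (-(r * Real.sin (r * t))) • α + Real.cos (r * t) • β

theorem hiA_deriv (r : ℝ) (hr : r ≠ 0) (α β : ℂ) (t : ℝ) :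
    HasDerivAt (hiA r α β) (hiB r α β t) t := by
  have h0 : HasDerivAt (fun s : ℝ => r * s) r t := by simpa using (hasDerivAt_id t).const_mul r
  have h1 := (h0.cos.smul_const α).add ((h0.sin.div_const r).smul_const β)
  refine HasDerivAt.congr_deriv h1 ?_
  rw [hiB]
  congr 2
  · ring
  · field_simp

theorem hiB_deriv (r : ℝ) (hr : r ≠ 0) (α β : ℂ) (t : ℝ) :
    HasDerivAt (hiB r α β) (-((r^2 : ℝ) : ℂ) * hiA r α β t) t := by
  have h0 : HasDerivAt (fun s : ℝ => r * s) r t := by simpa using (hasDerivAt_id t).const_mul r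
  have h1 := ((h0.sin.const_mul r).neg.smul_const α).add (h0.cos.smul_const β)
  refine HasDerivAt.congr_deriv h1 ?_
  have hr' : (r : ℂ) ≠ 0 := by exact_mod_cast hr
  simp only [hiA, Complex.real_smul]
  push_cast
  field_simp
  ring

theorem hiA_norm (r : ℝ) (hr : 0 < r) (α β : ℂ) (t : ℝ) : ‖hiA r α β t‖ ≤ ‖α‖ + ‖β‖ / r := by
  refine (norm_add_le _ _).trans ?_
  rw [norm_smul, norm_smul, norm_div, Real.norm_of_nonneg hr.le]
  have h1 : ‖Real.cos (r * t)‖ ≤ 1 := Real.abs_cos_le_one _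
  have h2 : ‖Real.sin (r * t)‖ ≤ 1 := Real.abs_sin_le_one _
  calc _ ≤ 1 * ‖α‖ + 1 / r * ‖β‖ := by gcongr
    _ = _ := by ring

theorem hiB_norm (r : ℝ) (hr : 0 < r) (α β : ℂ) (t : ℝ) : ‖hiB r α β t‖ ≤ r * ‖α‖ + ‖β‖ := by
  refine (norm_add_le _ _).trans ?_
  rw [norm_smul, norm_smul, norm_neg, norm_mul, Real.norm_of_nonneg hr.le]
  have h1 : ‖Real.cos (r * t)‖ ≤ 1 := Real.abs_cos_le_one _
  have h2 : ‖Real.sin (r * t)‖ ≤ 1 := Real.abs_sin_le_one _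
  calc _ ≤ r * 1 * ‖α‖ + 1 * ‖β‖ := by gcongr
    _ = _ := by ring

theorem hi_radius (N : ℕ) (n : Fin 3 → ℤ) (hn : n ∉ latticeBall N) : 1 ≤ Real.sqrt (nsqZ n) := by
  rw [mem_latticeBall, not_le] at hn
  have h1 : (0:ℤ) ≤ (N:ℤ)^2 := by positivity
  have h2 : 1 ≤ nsqZ n := by omega
  rw [Real.one_le_sqrt]
  exact_mod_cast h2

theorem full_exist (N : ℕ) (a₀ b₀ : (Fin 3 → ℤ) → ℂ) (ha : HermSymm a₀) (hb : HermSymm b₀) :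
    ∃ a b : ℝ → (Fin 3 → ℤ) → ℂ, (∀ n, a 0 n = a₀ n) ∧ (∀ n, b 0 n = b₀ n) ∧
      (∀ t, HermSymm (a t)) ∧
      (∀ t n, HasDerivAt (fun s => a s n) (b t n) t) ∧
      (∀ t n, HasDerivAt (fun s => b s n) (-((nsqZ n : ℝ) : ℂ) * a t n - cubicTrunc N (a t) n) t) ∧
      (∀ n ∉ latticeBall N, ∀ t, a t n = hiA (Real.sqrt (nsqZ n)) (a₀ n) (b₀ n) t) ∧
      (∀ n ∉ latticeBall N, ∀ t, b t n = hiB (Real.sqrt (nsqZ n)) (a₀ n) (b₀ n) t) := by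
  obtain ⟨A, B, h0, hH, hd⟩ := low_exist N a₀ b₀ ha hb
  let a : ℝ → (Fin 3 → ℤ) → ℂ := fun t n => if n ∈ latticeBall N then A t n else
    hiA (Real.sqrt (nsqZ n)) (a₀ n) (b₀ n) t
  let b : ℝ → (Fin 3 → ℤ) → ℂ := fun t n => if n ∈ latticeBall N then B t n else
    hiB (Real.sqrt (nsqZ n)) (a₀ n) (b₀ n) t
  have hcub : ∀ t n, cubicTrunc N (a t) n = cubicTrunc N (A t) n := fun t n =>
    cubicTrunc_congr N _ _ (fun m hm => by simp [a, hm]) n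
  refine ⟨a, b, fun n => ?_, fun n => ?_, fun t n => ?_, fun t n => ?_, fun t n => ?_,
    fun n hn t => by simp [a, hn], fun n hn t => by simp [b, hn]⟩
  · by_cases hn : n ∈ latticeBall N
    · simp [a, hn, h0 n hn]
    · simp [a, hn, hiA]
  · by_cases hn : n ∈ latticeBall N
    · simp [b, hn, h0 n hn]
    · simp [b, hn, hiB]
  · by_cases hn : n ∈ latticeBall N
    · simp only [a, hn, neg_mem_latticeBall, if_true]
      exact hH t n
    · simp only [a, hn, neg_mem_latticeBall, if_false, nsqZ_neg, ha n, hb n, hiA]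
      simp only [map_add, map_mul, Complex.real_smul, Complex.conj_ofReal]
  · by_cases hn : n ∈ latticeBall N
    · simpa only [a, b, hn, if_true] using (hd t n hn).1
    · have hr := hi_radius N n hn
      simp only [a, b, hn, if_false]
      exact hiA_deriv _ (by linarith) _ _ t
  · rw [hcub]
    by_cases hn : n ∈ latticeBall N
    · simpa only [a, b, hn, if_true] using (hd t n hn).2
    · have hr := hi_radius N n hn
      have := hiB_deriv (Real.sqrt (nsqZ n)) (by linarith) (a₀ n) (b₀ n) t
      rw [Real.sq_sqrt (nsqZ_nonneg n)] at this
      simpa only [a, b, hn, if_false, cubicTrunc_out N _ n hn, sub_zero] using this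

theorem full_bound (σ : ℝ) (N : ℕ) (a₀ b₀ : (Fin 3 → ℤ) → ℂ)
    (ha₀ : hNormSq σ a₀ ≠ ⊤) (hb₀ : hNormSq (σ - 1) b₀ ≠ ⊤) (τ : ℝ) (K : Set ℝ) (hK : IsCompact K)
    (c : ℝ → (Fin 3 → ℤ) → ℂ) (hc : ∀ n, Continuous (fun t => c t n))
    (h : ∀ n ∉ latticeBall N, ∀ t, (1 + (nsqZ n : ℝ)) ^ τ * ‖c t n‖^2 ≤
      4 * ((1 + (nsqZ n : ℝ)) ^ σ * ‖a₀ n‖^2 + (1 + (nsqZ n : ℝ)) ^ (σ - 1) * ‖b₀ n‖^2)) :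
    ∃ M : ℝ≥0∞, M ≠ ⊤ ∧ ∀ t ∈ K, hNormSq τ (c t) ≤ M := by
  choose C hC using fun n => hK.exists_bound_of_continuousOn (hc n).continuousOn
  have hw : ∀ (n : Fin 3 → ℤ) (s : ℝ), 0 ≤ (1 + (nsqZ n : ℝ)) ^ s := fun n s =>
    Real.rpow_nonneg (by linarith [nsqZ_nonneg n]) s
  refine ⟨∑' n, (4 * (ENNReal.ofReal ((1 + (nsqZ n : ℝ)) ^ σ) * (‖a₀ n‖₊ : ℝ≥0∞)^2 +
      ENNReal.ofReal ((1 + (nsqZ n : ℝ)) ^ (σ - 1)) * (‖b₀ n‖₊ : ℝ≥0∞)^2)) +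
      ∑ n ∈ latticeBall N, ENNReal.ofReal ((1 + (nsqZ n : ℝ)) ^ τ * (C n)^2), ?_, ?_⟩
  · rw [ENNReal.tsum_mul_left, ENNReal.tsum_add]
    refine ENNReal.add_ne_top.2 ⟨ENNReal.mul_ne_top (by simp) (ENNReal.add_ne_top.2 ⟨ha₀, hb₀⟩), ?_⟩
    exact ENNReal.sum_ne_top.2 fun n _ => ENNReal.ofReal_ne_top
  · intro t ht
    refine hNormSq_le τ N _ _ _ (fun n hn => ?_) (fun n hn => ?_)
    · rw [hterm _ (hw n _), hterm _ (hw n _), hterm _ (hw n _), ← ENNReal.ofReal_add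
        (mul_nonneg (hw n _) (by positivity)) (mul_nonneg (hw n _) (by positivity))]
      have h4 : (4 : ℝ≥0∞) = ENNReal.ofReal 4 := by simp
      rw [h4, ← ENNReal.ofReal_mul (by norm_num)]
      exact ENNReal.ofReal_le_ofReal (h n hn t)
    · rw [hterm _ (hw n _)]
      refine ENNReal.ofReal_le_ofReal (mul_le_mul_of_nonneg_left ?_ (hw n _))
      have := hC n t ht
      gcongr

/-- Global well-posedness of the truncated cubic NLW on `𝕋³` in `𝓗^σ`, `σ ≥ 1`
(Lemma 2.4 of the paper, finite truncation `N`), on the Fourier side: for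
Hermitian-symmetric data `(a⁰, b⁰) ∈ h^σ × h^{σ−1}` there is exactly one global `C²`
solution of `∂ₜ²a(n) = −|n|²a(n) − c_N(a)(n)`, and it is Hermitian-symmetric and bounded
in `h^σ × h^{σ−1}` on every compact time interval. -/
theorem truncated_nlw_gwp (σ : ℝ) (hσ : 1 ≤ σ) (N : ℕ)
    (a₀ b₀ : (Fin 3 → ℤ) → ℂ)
    (ha₀sym : HermSymm a₀) (hb₀sym : HermSymm b₀)
    (ha₀ : hNormSq σ a₀ ≠ ⊤) (hb₀ : hNormSq (σ - 1) b₀ ≠ ⊤) :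
    ∃ a : ℝ → (Fin 3 → ℤ) → ℂ,
      ((∀ n, ContDiff ℝ 2 (fun t => a t n)) ∧
        (∀ n, a 0 n = a₀ n) ∧
        (∀ n, deriv (fun t => a t n) 0 = b₀ n) ∧
        (∀ t n, deriv (deriv (fun t' => a t' n)) t
          = -(((nsqZ n : ℝ)) : ℂ) * a t n - cubicTrunc N (a t) n)) ∧
      (∀ t, HermSymm (a t)) ∧
      (∀ T : ℝ, 0 < T → ∃ M : ℝ≥0∞, M ≠ ⊤ ∧ ∀ t ∈ Set.Icc (-T) T,
          hNormSq σ (a t) ^ (1/2 : ℝ)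
            + hNormSq (σ - 1) (fun n => deriv (fun t' => a t' n) t) ^ (1/2 : ℝ) ≤ M) ∧
      (∀ a' : ℝ → (Fin 3 → ℤ) → ℂ,
        ((∀ n, ContDiff ℝ 2 (fun t => a' t n)) ∧
          (∀ n, a' 0 n = a₀ n) ∧
          (∀ n, deriv (fun t => a' t n) 0 = b₀ n) ∧
          (∀ t n, deriv (deriv (fun t' => a' t' n)) t
            = -(((nsqZ n : ℝ)) : ℂ) * a' t n - cubicTrunc N (a' t) n)) → a' = a) := by
  obtain ⟨a, b, h0, h1, hH, hd1, hd2, hA, hB⟩ := full_exist N a₀ b₀ ha₀sym hb₀sym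
  have hda : ∀ n, deriv (fun t => a t n) = fun t => b t n := fun n => funext fun t => (hd1 t n).deriv
  have hdb : ∀ n, deriv (fun t => b t n) =
      fun t => -((nsqZ n : ℝ) : ℂ) * a t n - cubicTrunc N (a t) n :=
    fun n => funext fun t => (hd2 t n).deriv
  have hac : ∀ n, Continuous (fun t => a t n) := fun n =>
    continuous_iff_continuousAt.2 fun t => (hd1 t n).continuousAt
  have hbc : ∀ n, Continuous (fun t => b t n) := fun n =>
    continuous_iff_continuousAt.2 fun t => (hd2 t n).continuousAt
  have hcc : ∀ n, Continuous (fun t => cubicTrunc N (a t) n) := by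
    intro n
    by_cases hn : n ∈ latticeBall N
    · simp only [cubicTrunc_eq N _ n hn]
      refine continuous_finset_sum _ fun m _ => continuous_finset_sum _ fun k _ =>
        continuous_finset_sum _ fun l _ => ?_
      split_ifs
      · exact ((hac m).mul (hac k)).mul (hac l)
      · exact continuous_const
    · simp only [cubicTrunc_out N _ n hn]
      exact continuous_const
  refine ⟨a, ⟨fun n => ?_, h0, fun n => by rw [hda]; exact h1 n, fun t n => by rw [hda, hdb]⟩, hH,
    fun T hT => ?_, ?_⟩
  · have hb1 : ContDiff ℝ 1 (fun t => b t n) := by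
      rw [contDiff_one_iff_deriv]
      refine ⟨fun t => (hd2 t n).differentiableAt, ?_⟩
      rw [hdb]
      exact (continuous_const.mul (hac n)).sub (hcc n)
    have : ContDiff ℝ (1 + 1) (fun t => a t n) := by
      rw [contDiff_succ_iff_deriv]
      refine ⟨fun t => (hd1 t n).differentiableAt, by simp, ?_⟩
      rw [hda]
      exact hb1
    rwa [one_add_one_eq_two] at this
  · have hsplit : ∀ n : Fin 3 → ℤ, (1 + (nsqZ n : ℝ)) ^ σ =
        (1 + (nsqZ n : ℝ)) ^ (σ - 1) * (1 + (nsqZ n : ℝ)) := by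
      intro n
      have hp : (0:ℝ) < 1 + (nsqZ n : ℝ) := by linarith [nsqZ_nonneg n]
      rw [Real.rpow_sub_one hp.ne']
      field_simp
    have hW : ∀ n : Fin 3 → ℤ, 0 ≤ (1 + (nsqZ n : ℝ)) ^ (σ - 1) := fun n =>
      Real.rpow_nonneg (by linarith [nsqZ_nonneg n]) _
    obtain ⟨M1, hM1, hb1⟩ := full_bound σ N a₀ b₀ ha₀ hb₀ σ (Set.Icc (-T) T) isCompact_Icc a hac (by
      intro n hn t
      have hr := hi_radius N n hn
      have hs := Real.sq_sqrt (nsqZ_nonneg n)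
      have e1 := hiA_norm (Real.sqrt (nsqZ n)) (by linarith) (a₀ n) (b₀ n) t
      have e2 := hi_bound1 _ ‖a₀ n‖ ‖b₀ n‖ hr
      rw [hs] at e2
      rw [hsplit, hA n hn]
      have e3 : ‖hiA (Real.sqrt (nsqZ n)) (a₀ n) (b₀ n) t‖^2 ≤
        (‖a₀ n‖ + ‖b₀ n‖ / Real.sqrt (nsqZ n))^2 := by gcongr
      have e4 := mul_le_mul_of_nonneg_left e3 (by linarith [nsqZ_nonneg n] : (0:ℝ) ≤ 1 + nsqZ n)
      have e5 := mul_le_mul_of_nonneg_left (e4.trans e2) (hW n)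
      linarith)
    obtain ⟨M2, hM2, hb2⟩ := full_bound σ N a₀ b₀ ha₀ hb₀ (σ - 1) (Set.Icc (-T) T) isCompact_Icc b hbc (by
      intro n hn t
      have hr := hi_radius N n hn
      have hs := Real.sq_sqrt (nsqZ_nonneg n)
      have e1 := hiB_norm (Real.sqrt (nsqZ n)) (by linarith) (a₀ n) (b₀ n) t
      have e2 := hi_bound2 (Real.sqrt (nsqZ n)) ‖a₀ n‖ ‖b₀ n‖
      rw [hs] at e2
      rw [hsplit, hB n hn]
      have e3 : ‖hiB (Real.sqrt (nsqZ n)) (a₀ n) (b₀ n) t‖^2 ≤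
        (Real.sqrt (nsqZ n) * ‖a₀ n‖ + ‖b₀ n‖)^2 := by gcongr
      have e5 := mul_le_mul_of_nonneg_left (e3.trans e2) (hW n)
      linarith)
    refine ⟨M1 ^ (1/2 : ℝ) + M2 ^ (1/2 : ℝ), ENNReal.add_ne_top.2
      ⟨ENNReal.rpow_ne_top_of_nonneg (by norm_num) hM1,
        ENNReal.rpow_ne_top_of_nonneg (by norm_num) hM2⟩, fun t ht => ?_⟩
    simp only [hda]
    exact add_le_add (ENNReal.rpow_le_rpow (hb1 t ht) (by norm_num))
      (ENNReal.rpow_le_rpow (hb2 t ht) (by norm_num))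
  · rintro a' ⟨hs, h0', h1', hd'⟩
    let b' : ℝ → (Fin 3 → ℤ) → ℂ := fun t n => deriv (fun t' => a' t' n) t
    have hd1' : ∀ t n, HasDerivAt (fun s => a' s n) (b' t n) t := fun t n =>
      ((hs n).differentiable (by norm_num) t).hasDerivAt
    have hd2' : ∀ t n, HasDerivAt (fun s => b' s n)
        (-((nsqZ n : ℝ) : ℂ) * a' t n - cubicTrunc N (a' t) n) t := by
      intro t n
      rw [← hd' t n]
      have hs2 : ContDiff ℝ (1 + 1) (fun t => a' t n) := by
        rw [one_add_one_eq_two]; exact hs n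
      have := (contDiff_succ_iff_deriv.1 hs2).2.2
      exact (this.differentiable (by norm_num) t).hasDerivAt
    have e0 : ∀ n, a' 0 n = a 0 n := fun n => by rw [h0', h0]
    have e1 : ∀ n, b' 0 n = b 0 n := fun n => by rw [h1]; exact h1' n
    have hlow := low_unique N a' b' a b e0 e1 (fun t n _ => ⟨hd1' t n, hd2' t n⟩)
      (fun t n _ => ⟨hd1 t n, hd2 t n⟩)
    funext t n
    by_cases hn : n ∈ latticeBall N
    · exact hlow t n hn
    · have := ode2_unique (E := ℂ) (fun z => ((nsqZ n : ℝ) : ℂ) * z) (contDiff_const.mul contDiff_id)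
        (fun t => a' t n) (fun t => b' t n) (fun t => a t n) (fun t => b t n)
        (fun t => hd1' t n)
        (fun t => by simpa only [cubicTrunc_out N _ n hn, sub_zero, neg_mul] using hd2' t n)
        (fun t => hd1 t n)
        (fun t => by simpa only [cubicTrunc_out N _ n hn, sub_zero, neg_mul] using hd2 t n)
        (e0 n) (e1 n)
      exact congrFun this t
end
end

section
/- Let σ ≥ 1 be a real number. For all R, T > 0 there exists C > 0 with the following property: for every N ∈ ℕ, every pair of Hermitian-symmetric data a⁰, b⁰ : ℤ³ → ℂ with ‖a⁰‖²_{h^σ} + ‖b⁰‖²_{h^{σ−1}} ≤ R², and every a : ℝ → (ℤ³ → ℂ) such that each t ↦ a(t)(n) is twice continuously differentiable, a(0) = a⁰, (∂_t a)(0) = b⁰, a(t) is Hermitian-symmetric for all t, (∂_t² a)(t)(n) = −|n|² a(t)(n) − c_N(a(t))(n) for all t, n, and sup_{t∈[0,T]} (‖a(t)‖_{h^σ} + ‖(∂_t a)(t)‖_{h^{σ−1}}) < ∞, one has ‖a(t)‖²_{h^σ} + ‖(∂_t a)(t)‖²_{h^{σ−1}} ≤ C² for all t ∈ [0,T]. In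 particular, C depends only on R, T and σ, and not on N. -/
open scoped ENNReal NNReal BigOperators

noncomputable section

abbrev Zc := Fin 3 → ℤ

def ww (n : Zc) : ℝ := 1 + (nsqZ n : ℝ)

lemma nsqZ_eq (n : Zc) : nsqZ n = n 0 ^ 2 + n 1 ^ 2 + n 2 ^ 2 := by
  simp [nsqZ, Fin.sum_univ_three]

lemma ww_eq (n : Zc) : ww n = 1 + ((n 0 : ℝ) ^ 2 + (n 1 : ℝ) ^ 2 + (n 2 : ℝ) ^ 2) := by
  simp [ww, nsqZ_eq]

lemma ww_one_le (n : Zc) : 1 ≤ ww n := by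
  rw [ww_eq]; nlinarith [sq_nonneg (n 0 : ℝ), sq_nonneg (n 1 : ℝ), sq_nonneg (n 2 : ℝ)]

lemma ww_pos (n : Zc) : 0 < ww n := lt_of_lt_of_le one_pos (ww_one_le n)

lemma ww_add3 (p q r : Zc) : ww (p + q + r) ≤ 3 * (ww p + ww q + ww r) := by
  have key : ∀ a b c : ℝ, (a + b + c) ^ 2 ≤ 3 * (a ^ 2 + b ^ 2 + c ^ 2) := by
    intro a b c
    nlinarith [sq_nonneg (a - b), sq_nonneg (b - c), sq_nonneg (a - c)]
  simp only [ww_eq, Pi.add_apply, Int.cast_add]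
  linarith [key (p 0) (q 0) (r 0), key (p 1) (q 1) (r 1), key (p 2) (q 2) (r 2)]

lemma ww_add3' (p q r : Zc) : ww p ≤ 3 * (ww (p + q + r) + ww q + ww r) := by
  have h := ww_add3 (p + q + r) (-q) (-r)
  have e : p + q + r + -q + -r = p := by abel
  have hn : ∀ x : Zc, ww (-x) = ww x := by intro x; simp [ww_eq]
  rw [e, hn, hn] at h
  exact h

lemma mem_ball (N : ℕ) (n : Zc) : n ∈ latticeBall N ↔ nsqZ n ≤ (N : ℤ) ^ 2 := by
  simp only [latticeBall, Finset.mem_filter, Finset.mem_Icc, and_iff_right_iff_imp, Pi.le_def]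
  intro h
  rw [nsqZ_eq] at h
  have h0 : ∀ i, (n i) ^ 2 ≤ (N : ℤ) ^ 2 := by
    intro i
    fin_cases i <;> simp <;> nlinarith [sq_nonneg (n 0), sq_nonneg (n 1), sq_nonneg (n 2)]
  have h1 : ∀ i, |n i| ≤ (N : ℤ) := fun i => abs_le_of_sq_le_sq (h0 i) (by positivity)
  exact ⟨fun i => (abs_le.1 (h1 i)).1, fun i => (abs_le.1 (h1 i)).2⟩

lemma neg_mem_ball {N : ℕ} {n : Zc} (h : n ∈ latticeBall N) : -n ∈ latticeBall N := by
  rw [mem_ball] at *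
  simpa [nsqZ] using h

def cube (M : ℕ) : Finset Zc := Finset.Icc (fun _ => -(M : ℤ)) (fun _ => (M : ℤ))

lemma card_cube (M : ℕ) : ((cube M).card : ℝ) = (2 * M + 1) ^ 3 := by
  have : (cube M).card = (2 * M + 1) ^ 3 := by
    rw [cube, Pi.card_Icc]
    simp
    omega
  rw [this]; push_cast; ring

lemma cube_sum (M : ℕ) : ∑ q ∈ cube M, (ww q)⁻¹ ≤ 1 + 26 * M := by
  induction M with
  | zero =>
    have : cube 0 = {0} := by
      ext x; simp [cube, funext_iff]
    rw [this]; simp [ww_eq]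
  | succ M ih =>
    have hsub : cube M ⊆ cube (M + 1) := by
      apply Finset.Icc_subset_Icc
      · intro i; simp
      · intro i; simp
    rw [← Finset.sum_sdiff hsub]
    have hb : ∀ q ∈ cube (M + 1) \ cube M, (ww q)⁻¹ ≤ (1 + ((M : ℝ) + 1) ^ 2)⁻¹ := by
      intro q hq
      rw [Finset.mem_sdiff] at hq
      obtain ⟨-, h2⟩ := hq
      apply inv_anti₀ (by positivity)
      by_contra hlt
      push Not at hlt
      apply h2
      simp only [cube, Finset.mem_Icc, Pi.le_def, ← forall_and]
      have hlt' : nsqZ q < ((M : ℤ) + 1) ^ 2 := by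
        have : (nsqZ q : ℝ) < ((M : ℝ) + 1) ^ 2 := by unfold ww at hlt; linarith
        exact_mod_cast this
      rw [nsqZ_eq] at hlt'
      intro i
      have hi : (q i) ^ 2 < ((M : ℤ) + 1) ^ 2 := by
        fin_cases i <;> simp <;> nlinarith [sq_nonneg (q 0), sq_nonneg (q 1), sq_nonneg (q 2)]
      have := abs_lt.1 (abs_lt_of_sq_lt_sq hi (by positivity))
      constructor <;> omega
    have hc : ((cube (M + 1) \ cube M).card : ℝ) = 24 * ((M : ℝ) + 1) ^ 2 + 2 := by
      rw [Finset.card_sdiff_of_subset hsub, Nat.cast_sub (Finset.card_le_card hsub), card_cube,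
        card_cube]
      push_cast; ring
    have h1 := Finset.sum_le_card_nsmul _ _ _ hb
    rw [nsmul_eq_mul, hc] at h1
    have h2 : (24 * ((M : ℝ) + 1) ^ 2 + 2) * (1 + ((M : ℝ) + 1) ^ 2)⁻¹ ≤ 26 := by
      rw [← div_eq_mul_inv, div_le_iff₀ (by positivity)]
      nlinarith [sq_nonneg ((M : ℝ) + 1)]
    push_cast
    linarith

lemma lattice_sum (B : Finset Zc) (X : ℝ) (hX : 1 ≤ X) :
    ∑ q ∈ B, (if ww q ≤ X then (ww q)⁻¹ else 0) ≤ 27 * √X := by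
  rw [← Finset.sum_filter]
  have hs : 1 ≤ √X := Real.one_le_sqrt.2 hX
  have hfl : ((⌊√X⌋₊ : ℕ) : ℝ) ≤ √X := Nat.floor_le (by positivity)
  have hsub : B.filter (fun q => ww q ≤ X) ⊆ cube ⌊√X⌋₊ := by
    intro q hq
    rw [Finset.mem_filter] at hq
    have hq := hq.2
    have hk : ∀ i, |(q i : ℝ)| ≤ √X := by
      intro i
      apply Real.abs_le_sqrt
      rw [ww_eq] at hq
      fin_cases i <;> simp <;>
        nlinarith [sq_nonneg (q 0 : ℝ), sq_nonneg (q 1 : ℝ), sq_nonneg (q 2 : ℝ)]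
    have hk2 : ∀ i, |q i| ≤ (⌊√X⌋₊ : ℤ) := by
      intro i
      have h1 : (q i).natAbs ≤ ⌊√X⌋₊ := by
        apply Nat.le_floor
        rw [Nat.cast_natAbs]; push_cast; exact hk i
      rw [Int.abs_eq_natAbs]; exact_mod_cast h1
    simp only [cube, Finset.mem_Icc, Pi.le_def]
    exact ⟨fun i => (abs_le.1 (hk2 i)).1, fun i => (abs_le.1 (hk2 i)).2⟩
  calc _ ≤ ∑ q ∈ cube ⌊√X⌋₊, (ww q)⁻¹ :=
        Finset.sum_le_sum_of_subset_of_nonneg hsub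
          (fun i _ _ => inv_nonneg.2 (ww_pos i).le)
    _ ≤ 1 + 26 * (⌊√X⌋₊ : ℕ) := cube_sum _
    _ ≤ 27 * √X := by linarith

lemma shift_sum (B : Finset Zc) (c : Zc) (φ : Zc → ℝ) (h0 : ∀ n, 0 ≤ φ n)
    (hs : ∀ n, n ∉ B → φ n = 0) : ∑ p ∈ B, φ (p + c) ≤ ∑ n ∈ B, φ n := by
  have : ∑ p ∈ B, φ (p + c) = ∑ n ∈ B.map (addRightEmbedding c), φ n := by
    simp [Finset.sum_map]
  rw [this, ← Finset.sum_filter_add_sum_filter_not (B.map (addRightEmbedding c)) (· ∈ B)]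
  have h2 : ∑ n ∈ (B.map (addRightEmbedding c)).filter (fun n => ¬ n ∈ B), φ n = 0 :=
    Finset.sum_eq_zero (fun n hn => hs n (Finset.mem_filter.1 hn).2)
  rw [h2, add_zero]
  exact Finset.sum_le_sum_of_subset_of_nonneg
    (fun n hn => (Finset.mem_filter.1 hn).2) (fun i _ _ => h0 i)

lemma amgm_ker (F G H u P Q R : ℝ) (hP : 0 < P) (hQ : 0 < Q) (hR : 0 < R) :
    F * G * H * u ≤
      P * F ^ 2 * (Q * G ^ 2) * ((√P)⁻¹ * R⁻¹) + R * H ^ 2 * u ^ 2 * ((√P)⁻¹ * Q⁻¹) := by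
  obtain ⟨p, hp, rfl⟩ : ∃ p : ℝ, 0 < p ∧ P = p ^ 2 :=
    ⟨√P, Real.sqrt_pos.2 hP, (Real.sq_sqrt hP.le).symm⟩
  obtain ⟨q, hq, rfl⟩ : ∃ p : ℝ, 0 < p ∧ Q = p ^ 2 :=
    ⟨√Q, Real.sqrt_pos.2 hQ, (Real.sq_sqrt hQ.le).symm⟩
  obtain ⟨r, hr, rfl⟩ : ∃ p : ℝ, 0 < p ∧ R = p ^ 2 :=
    ⟨√R, Real.sqrt_pos.2 hR, (Real.sq_sqrt hR.le).symm⟩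
  rw [Real.sqrt_sq hp.le]
  have e : p ^ 2 * F ^ 2 * (q ^ 2 * G ^ 2) * (p⁻¹ * (r ^ 2)⁻¹)
      + r ^ 2 * H ^ 2 * u ^ 2 * (p⁻¹ * (q ^ 2)⁻¹)
      = p⁻¹ * ((p * F * q * G * r⁻¹) ^ 2 + (r * H * u * q⁻¹) ^ 2) := by
    field_simp
  have e2 : F * G * H * u = p⁻¹ * ((p * F * q * G * r⁻¹) * (r * H * u * q⁻¹)) := by
    field_simp
  rw [e, e2]
  apply mul_le_mul_of_nonneg_left _ (by positivity)
  nlinarith [sq_nonneg (p * F * q * G * r⁻¹ - r * H * u * q⁻¹),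
    sq_nonneg (p * F * q * G * r⁻¹), sq_nonneg (r * H * u * q⁻¹)]

def Reg (p q r : Zc) : Prop :=
  ww q ≤ ww p ∧ ww r ≤ ww p ∧ ww p ≤ 9 * max (ww r) (ww (p + q + r))

open Classical in
lemma tri (B : Finset Zc) (f x u : Zc → ℝ)
    (hu : ∀ n, n ∉ B → u n = 0) :
    ∑ p ∈ B, ∑ q ∈ B, ∑ r ∈ B, (if Reg p q r then f p * x q * x r * u (p + q + r) else 0)
    ≤ 243 * ((∑ p ∈ B, ww p * f p ^ 2) * (∑ q ∈ B, ww q * x q ^ 2)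
        + (∑ r ∈ B, ww r * x r ^ 2) * (∑ n ∈ B, u n ^ 2)) := by
  set k1 : Zc → Zc → ℝ := fun p r => (√(ww p))⁻¹ * (if ww r ≤ ww p then (ww r)⁻¹ else 0) with hk1
  set D : Zc → Zc → ℝ := fun r n => max (ww r) (ww n) with hD
  set k2 : Zc → Zc → Zc → ℝ := fun r q n =>
    3 * (√(D r n))⁻¹ * (if ww q ≤ 9 * D r n then (ww q)⁻¹ else 0) with hk2
  have hD1 : ∀ r n, 1 ≤ D r n := fun r n => le_max_of_le_left (ww_one_le r)
  have k2nn : ∀ r q n, 0 ≤ k2 r q n := by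
    intro r q n
    simp only [hk2]
    have := (ww_pos q).le
    split_ifs <;> positivity
  have step : ∀ p q r, (if Reg p q r then f p * x q * x r * u (p + q + r) else 0)
      ≤ ww p * f p ^ 2 * (ww q * x q ^ 2) * k1 p r
        + ww r * x r ^ 2 * (u (p + q + r) ^ 2 * k2 r q (p + q + r)) := by
    intro p q r
    have hP := ww_pos p
    have hQ := ww_pos q
    have hR := ww_pos r
    by_cases h : Reg p q r
    · rw [if_pos h]
      obtain ⟨h1, h2, h3⟩ := h
      refine (amgm_ker _ _ _ _ _ _ _ hP hQ hR).trans ?_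
      have e1 : k1 p r = (√(ww p))⁻¹ * (ww r)⁻¹ := by simp only [hk1]; rw [if_pos h2]
      rw [e1]
      have hDP : D r (p + q + r) ≤ 9 * ww p := by
        apply max_le
        · linarith
        · linarith [ww_add3 p q r]
      have e2 : k2 r q (p + q + r) = 3 * (√(D r (p + q + r)))⁻¹ * (ww q)⁻¹ := by
        simp only [hk2]; rw [if_pos (by linarith)]
      rw [e2]
      have e3 : (√(ww p))⁻¹ ≤ 3 * (√(D r (p + q + r)))⁻¹ := by
        have hd := hD1 r (p + q + r)
        have : √(D r (p + q + r)) ≤ 3 * √(ww p) := by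
          rw [show (3:ℝ) * √(ww p) = √(9 * ww p) by
            rw [Real.sqrt_mul (by norm_num)]; congr 1
            rw [show (9:ℝ) = 3 ^ 2 by norm_num, Real.sqrt_sq (by norm_num)]]
          exact Real.sqrt_le_sqrt hDP
        have s1 : 0 < √(D r (p + q + r)) := Real.sqrt_pos.2 (by linarith)
        have s2 : 0 < √(ww p) := Real.sqrt_pos.2 hP
        rw [← div_eq_mul_inv, le_div_iff₀ s1, inv_mul_le_iff₀ s2]
        linarith
      have : (√(ww p))⁻¹ * (ww q)⁻¹ ≤ 3 * (√(D r (p + q + r)))⁻¹ * (ww q)⁻¹ :=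
        mul_le_mul_of_nonneg_right e3 (inv_nonneg.2 hQ.le)
      have := mul_le_mul_of_nonneg_left this
        (show 0 ≤ ww r * x r ^ 2 * u (p + q + r) ^ 2 by positivity)
      linarith
    · rw [if_neg h]
      have := k2nn r q (p + q + r)
      have : 0 ≤ k1 p r := by
        simp only [hk1]
        split_ifs <;> positivity
      positivity
  calc _ ≤ ∑ p ∈ B, ∑ q ∈ B, ∑ r ∈ B, (ww p * f p ^ 2 * (ww q * x q ^ 2) * k1 p r
        + ww r * x r ^ 2 * (u (p + q + r) ^ 2 * k2 r q (p + q + r))) := by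
        gcongr; exact step _ _ _
    _ = ∑ p ∈ B, ∑ q ∈ B, ww p * f p ^ 2 * (ww q * x q ^ 2) * (∑ r ∈ B, k1 p r)
        + ∑ r ∈ B, ∑ q ∈ B, ww r * x r ^ 2 *
            ∑ p ∈ B, (u (p + q + r) ^ 2 * k2 r q (p + q + r)) := by
        simp only [Finset.sum_add_distrib, Finset.mul_sum]
        congr 1
        rw [Finset.sum_comm' (t' := B) (s' := fun _ => B) (by simp)]
        rw [Finset.sum_congr rfl (fun q _ => Finset.sum_comm)]
        rw [Finset.sum_comm]
    _ ≤ ∑ p ∈ B, ∑ q ∈ B, ww p * f p ^ 2 * (ww q * x q ^ 2) * 27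
        + ∑ r ∈ B, ∑ q ∈ B, ww r * x r ^ 2 * ∑ n ∈ B, (u n ^ 2 * k2 r q n) := by
        apply add_le_add
        · apply Finset.sum_le_sum; intro p _
          apply Finset.sum_le_sum; intro q _
          have hP := ww_pos p
          have hQ := ww_pos q
          apply mul_le_mul_of_nonneg_left _ (by positivity)
          simp only [hk1]
          rw [← Finset.mul_sum, inv_mul_le_iff₀ (Real.sqrt_pos.2 hP), mul_comm]
          exact lattice_sum B _ (ww_one_le p)
        · apply Finset.sum_le_sum; intro r _
          apply Finset.sum_le_sum; intro q _
          have hR := ww_pos r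
          apply mul_le_mul_of_nonneg_left _ (by positivity)
          have := shift_sum B (q + r) (fun n => u n ^ 2 * k2 r q n)
            (fun n => mul_nonneg (sq_nonneg _) (k2nn r q n))
            (fun n hn => by simp [hu n hn])
          simpa only [← add_assoc] using this
    _ = (∑ p ∈ B, ∑ q ∈ B, ww p * f p ^ 2 * (ww q * x q ^ 2)) * 27
        + ∑ r ∈ B, ∑ n ∈ B, ww r * x r ^ 2 * u n ^ 2 * ∑ q ∈ B, k2 r q n := by
        congr 1
        · simp only [Finset.sum_mul]
        · apply Finset.sum_congr rfl; intro r _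
          simp only [Finset.mul_sum]
          rw [Finset.sum_comm]
          simp only [mul_assoc]
    _ ≤ (∑ p ∈ B, ∑ q ∈ B, ww p * f p ^ 2 * (ww q * x q ^ 2)) * 27
        + ∑ r ∈ B, ∑ n ∈ B, ww r * x r ^ 2 * u n ^ 2 * 243 := by
        gcongr with r _ n _
        · have := (ww_pos r).le
          positivity
        · simp only [hk2]
          rw [← Finset.mul_sum]
          have hd := hD1 r n
          have := lattice_sum B (9 * D r n) (by linarith)
          have e9 : √(9 * D r n) = 3 * √(D r n) := by
            rw [Real.sqrt_mul (by norm_num)]; congr 1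
            rw [show (9:ℝ) = 3 ^ 2 by norm_num, Real.sqrt_sq (by norm_num)]
          rw [e9] at this
          have s1 : 0 < √(D r n) := Real.sqrt_pos.2 (by linarith)
          rw [mul_assoc, mul_comm (3:ℝ), mul_assoc, inv_mul_le_iff₀ s1]
          linarith
    _ ≤ _ := by
        rw [Finset.sum_mul_sum, Finset.sum_mul_sum, mul_add, Finset.mul_sum, Finset.mul_sum,
          Finset.sum_mul]
        apply add_le_add
        · apply Finset.sum_le_sum; intro p _
          rw [mul_comm]
          apply mul_le_mul_of_nonneg_right (by norm_num)
          apply Finset.sum_nonneg; intro q _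
          have hP := ww_pos p
          have hQ := ww_pos q
          positivity
        · apply le_of_eq
          apply Finset.sum_congr rfl; intro p _
          rw [Finset.mul_sum]
          apply Finset.sum_congr rfl; intro n _
          ring

open Classical in
lemma tri_full (s : ℝ) (hs : 0 ≤ s) (B : Finset Zc) (x y : Zc → ℝ) (hx : ∀ n, 0 ≤ x n)
    (hy : ∀ n, 0 ≤ y n) :
    ∑ p ∈ B, ∑ q ∈ B, ∑ r ∈ B,
      (if p + q + r ∈ B then ww (p + q + r) ^ s * y (p + q + r) * (x p * x q * x r) else 0)
    ≤ (1458 * (9:ℝ) ^ (s / 2)) * ((∑ p ∈ B, ww p * x p ^ 2) *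
        (∑ q ∈ B, ww q ^ s * (ww q * x q ^ 2 + y q ^ 2))) := by
  set ρ : Zc → ℝ := fun n => ww n ^ (s / 2) with hρ
  have ρnn : ∀ n, 0 ≤ ρ n := fun n => Real.rpow_nonneg (ww_pos n).le _
  have ρsq : ∀ n, ww n ^ s = ρ n * ρ n := by
    intro n
    simp only [hρ]
    rw [← Real.rpow_add (ww_pos n)]; congr 1; ring
  set u : Zc → ℝ := fun n => if n ∈ B then ρ n * y n else 0 with hu
  have unn : ∀ n, 0 ≤ u n := by
    intro n; simp only [hu]; split_ifs
    · exact mul_nonneg (ρnn n) (hy n)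
    · exact le_rfl
  set f : Zc → ℝ := fun n => ρ n * x n with hf
  have fnn : ∀ n, 0 ≤ f n := fun n => mul_nonneg (ρnn n) (hx n)
  set c : ℝ := (9:ℝ) ^ (s / 2) with hc
  have cnn : 0 ≤ c := by positivity
  set A' : Zc → Zc → Zc → ℝ := fun p q r =>
    if Reg p q r then f p * x q * x r * u (p + q + r) else 0 with hA'
  set A : Zc → Zc → Zc → ℝ := fun p q r =>
    if ww q ≤ ww p ∧ ww r ≤ ww p then f p * x q * x r * u (p + q + r) else 0 with hA
  have nn : ∀ p q r, 0 ≤ f p * x q * x r * u (p + q + r) := fun p q r =>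
    mul_nonneg (mul_nonneg (mul_nonneg (fnn p) (hx q)) (hx r)) (unn _)
  have Ann : ∀ p q r, 0 ≤ A p q r := by
    intro p q r; simp only [hA]; split_ifs
    · exact nn p q r
    · exact le_rfl
  have A'nn : ∀ p q r, 0 ≤ A' p q r := by
    intro p q r; simp only [hA']; split_ifs
    · exact nn p q r
    · exact le_rfl
  have ρmono : ∀ n p, ww n ≤ 9 * ww p → ρ n ≤ c * ρ p := by
    intro n p h
    simp only [hρ, hc]
    rw [← Real.mul_rpow (by norm_num) (ww_pos p).le]
    exact Real.rpow_le_rpow (ww_pos n).le h (by linarith)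
  have main1 : ∀ p q r, ww q ≤ ww p → ww r ≤ ww p →
      (if p + q + r ∈ B then ww (p + q + r) ^ s * y (p + q + r) * (x p * x q * x r) else 0)
      ≤ c * A p q r := by
    intro p q r h1 h2
    have eA : A p q r = f p * x q * x r * u (p + q + r) := by
      simp only [hA]; rw [if_pos ⟨h1, h2⟩]
    rw [eA]
    split_ifs with h
    · have eu : u (p + q + r) = ρ (p + q + r) * y (p + q + r) := by
        simp only [hu]; rw [if_pos h]
      rw [eu, ρsq]
      simp only [hf]
      have := ρmono (p + q + r) p (by linarith [ww_add3 p q r])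
      have h3 : 0 ≤ ρ (p + q + r) * y (p + q + r) * (x p * x q * x r) :=
        mul_nonneg (mul_nonneg (ρnn _) (hy _)) (mul_nonneg (mul_nonneg (hx _) (hx _)) (hx _))
      have := mul_le_mul_of_nonneg_right this h3
      linarith
    · exact mul_nonneg cnn (nn p q r)
  have main : ∀ p q r,
      (if p + q + r ∈ B then ww (p + q + r) ^ s * y (p + q + r) * (x p * x q * x r) else 0)
      ≤ c * (A p q r + A q p r + A r p q) := by
    intro p q r
    have a1 := mul_nonneg cnn (Ann p q r)
    have a2 := mul_nonneg cnn (Ann q p r)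
    have a3 := mul_nonneg cnn (Ann r p q)
    rw [mul_add, mul_add]
    rcases le_total (ww p) (ww q) with h1 | h1
    · rcases le_total (ww q) (ww r) with h2 | h2
      · have := main1 r p q (h1.trans h2) h2
        rw [show r + p + q = p + q + r by abel,
          show x r * x p * x q = x p * x q * x r by ring] at this
        linarith
      · have := main1 q p r h1 h2
        rw [show q + p + r = p + q + r by abel,
          show x q * x p * x r = x p * x q * x r by ring] at this
        linarith
    · rcases le_total (ww p) (ww r) with h2 | h2
      · have := main1 r p q h2 (h1.trans h2)
        rw [show r + p + q = p + q + r by abel,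
          show x r * x p * x q = x p * x q * x r by ring] at this
        linarith
      · have := main1 p q r h1 h2
        linarith
  have split : ∀ p q r, A p q r ≤ A' p q r + A' p r q := by
    intro p q r
    by_cases h : ww q ≤ ww p ∧ ww r ≤ ww p
    · have e : A p q r = f p * x q * x r * u (p + q + r) := by simp only [hA]; rw [if_pos h]
      have hw := ww_add3' p q r
      have key : Reg p q r ∨ Reg p r q := by
        by_contra hcon
        push Not at hcon
        obtain ⟨c1, c2⟩ := hcon
        have d1 : ¬ ww p ≤ 9 * max (ww r) (ww (p + q + r)) := fun h' => c1 ⟨h.1, h.2, h'⟩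
        have d2 : ¬ ww p ≤ 9 * max (ww q) (ww (p + r + q)) := fun h' => c2 ⟨h.2, h.1, h'⟩
        push Not at d1 d2
        have := le_max_left (ww r) (ww (p + q + r))
        have := le_max_right (ww r) (ww (p + q + r))
        have := le_max_left (ww q) (ww (p + r + q))
        linarith
      rcases key with k | k
      · have : A' p q r = f p * x q * x r * u (p + q + r) := by simp only [hA']; rw [if_pos k]
        linarith [A'nn p r q]
      · have : A' p r q = f p * x q * x r * u (p + q + r) := by
          simp only [hA']; rw [if_pos k, show p + r + q = p + q + r by abel]; ring
        linarith [A'nn p q r]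
    · have e : A p q r = 0 := by simp only [hA]; rw [if_neg h]
      rw [e]; exact add_nonneg (A'nn _ _ _) (A'nn _ _ _)
  have sw1 : ∑ p ∈ B, ∑ q ∈ B, ∑ r ∈ B, A q p r = ∑ p ∈ B, ∑ q ∈ B, ∑ r ∈ B, A p q r :=
    Finset.sum_comm
  have sw2 : ∑ p ∈ B, ∑ q ∈ B, ∑ r ∈ B, A r p q = ∑ p ∈ B, ∑ q ∈ B, ∑ r ∈ B, A p q r := by
    rw [Finset.sum_congr rfl (fun p _ => Finset.sum_comm)]
    exact Finset.sum_comm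
  have sw3 : ∑ p ∈ B, ∑ q ∈ B, ∑ r ∈ B, A' p r q = ∑ p ∈ B, ∑ q ∈ B, ∑ r ∈ B, A' p q r :=
    Finset.sum_congr rfl (fun p _ => Finset.sum_comm)
  have hA1 : ∑ p ∈ B, ∑ q ∈ B, ∑ r ∈ B, A p q r
      ≤ 2 * ∑ p ∈ B, ∑ q ∈ B, ∑ r ∈ B, A' p q r := by
    calc _ ≤ ∑ p ∈ B, ∑ q ∈ B, ∑ r ∈ B, (A' p q r + A' p r q) := by
          gcongr; exact split _ _ _
      _ = _ := by
          simp only [Finset.sum_add_distrib]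
          rw [sw3]; ring
  have htri := tri B f x u (fun n hn => by simp only [hu]; rw [if_neg hn])
  have e1 : (∑ p ∈ B, ww p * f p ^ 2) + ∑ n ∈ B, u n ^ 2
      = ∑ q ∈ B, ww q ^ s * (ww q * x q ^ 2 + y q ^ 2) := by
    rw [← Finset.sum_add_distrib]
    apply Finset.sum_congr rfl
    intro n hn
    simp only [hu, hf, if_pos hn]
    rw [ρsq]; ring
  calc _ ≤ ∑ p ∈ B, ∑ q ∈ B, ∑ r ∈ B, c * (A p q r + A q p r + A r p q) := by
        gcongr; exact main _ _ _
    _ = c * (3 * ∑ p ∈ B, ∑ q ∈ B, ∑ r ∈ B, A p q r) := by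
        simp only [← Finset.mul_sum, Finset.sum_add_distrib]
        rw [sw1, sw2]; ring
    _ ≤ c * (3 * (2 * (243 * ((∑ p ∈ B, ww p * f p ^ 2) * (∑ q ∈ B, ww q * x q ^ 2)
        + (∑ r ∈ B, ww r * x r ^ 2) * (∑ n ∈ B, u n ^ 2))))) := by
        gcongr
        exact hA1.trans (by gcongr)
    _ = _ := by rw [← e1]; ring

lemma conv_sum {E : Type*} [AddCommMonoid E] (B : Finset Zc) (Φ : Zc → Zc → Zc → Zc → E) :
    ∑ n ∈ B, ∑ m ∈ B, ∑ k ∈ B, (if n - m - k ∈ B then Φ n m k (n - m - k) else 0)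
    = ∑ m ∈ B, ∑ k ∈ B, ∑ r ∈ B, (if m + k + r ∈ B then Φ (m + k + r) m k r else 0) := by
  rw [Finset.sum_comm]
  apply Finset.sum_congr rfl; intro m _
  rw [Finset.sum_comm]
  apply Finset.sum_congr rfl; intro k _
  rw [← Finset.sum_filter, ← Finset.sum_filter]
  refine Finset.sum_nbij' (fun n => n - m - k) (fun r => m + k + r) ?_ ?_ ?_ ?_ ?_
  · intro n hn
    rw [Finset.mem_filter] at hn ⊢
    refine ⟨hn.2, ?_⟩
    rw [show m + k + (n - m - k) = n by abel]; exact hn.1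
  · intro r hr
    rw [Finset.mem_filter] at hr ⊢
    refine ⟨hr.2, ?_⟩
    rw [show m + k + r - m - k = r by abel]; exact hr.1
  · intro n _; show m + k + (n - m - k) = n; abel
  · intro n _; show m + k + n - m - k = n; abel
  · intro n _; show _ = Φ (m + k + (n - m - k)) m k (n - m - k)
    rw [show m + k + (n - m - k) = n by abel]

lemma cubic_on_ball (N : ℕ) (a : Zc → ℂ) (n : Zc) (hn : n ∈ latticeBall N) :
    cubicTrunc N a n = ∑ m ∈ latticeBall N, ∑ k ∈ latticeBall N,
      (if n - m - k ∈ latticeBall N then a m * a k * a (n - m - k) else 0) := by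
  rw [cubicTrunc, if_pos ((mem_ball N n).1 hn)]
  simp only [mem_ball]

lemma NL (s : ℝ) (hs : 0 ≤ s) (N : ℕ) (a z : Zc → ℂ) :
    ∑ n ∈ latticeBall N, ww n ^ s * ‖z n‖ * ‖cubicTrunc N a n‖
    ≤ (1458 * (9:ℝ) ^ (s / 2)) * ((∑ p ∈ latticeBall N, ww p * ‖a p‖ ^ 2) *
        (∑ q ∈ latticeBall N, ww q ^ s * (ww q * ‖a q‖ ^ 2 + ‖z q‖ ^ 2))) := by
  refine le_trans ?_ (tri_full s hs (latticeBall N) (fun n => ‖a n‖) (fun n => ‖z n‖)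
    (fun _ => norm_nonneg _) (fun _ => norm_nonneg _))
  have := conv_sum (latticeBall N)
    (fun n m k r => ww n ^ s * ‖z n‖ * (‖a m‖ * ‖a k‖ * ‖a r‖))
  calc _ ≤ _ := ?_
    _ = _ := this
    _ ≤ _ := ?_
  · apply Finset.sum_le_sum; intro n hn
    rw [cubic_on_ball N a n hn]
    have hw : 0 ≤ ww n ^ s * ‖z n‖ := mul_nonneg (Real.rpow_nonneg (ww_pos n).le _) (norm_nonneg _)
    refine (mul_le_mul_of_nonneg_left ((norm_sum_le _ _).trans
      (Finset.sum_le_sum fun m _ => norm_sum_le _ _)) hw).trans ?_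
    simp only [Finset.mul_sum]
    apply le_of_eq
    apply Finset.sum_congr rfl; intro m _
    apply Finset.sum_congr rfl; intro k _
    split_ifs <;> simp
  · apply le_of_eq
    apply Finset.sum_congr rfl; intro m _
    apply Finset.sum_congr rfl; intro k _
    apply Finset.sum_congr rfl; intro r _
    split_ifs <;> simp

def KK (N : ℕ) : Finset Zc := (latticeBall N ×ˢ latticeBall N).image (fun x => x.1 + x.2)

def bb (N : ℕ) (z a : Zc → ℂ) (k : Zc) : ℂ :=
  ∑ p ∈ latticeBall N, ∑ q ∈ latticeBall N, (if p + q = k then z p * a q else 0)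

lemma Vid (N : ℕ) (z a : Zc → ℂ) (ha : HermSymm a) :
    ∑ k ∈ KK N, (starRingEnd ℂ) (bb N a a k) * bb N z a k
      = ∑ p ∈ latticeBall N, z p * (starRingEnd ℂ) (cubicTrunc N a p) := by
  have h1 : ∑ k ∈ KK N, (starRingEnd ℂ) (bb N a a k) * bb N z a k
      = ∑ p ∈ latticeBall N, ∑ q ∈ latticeBall N,
          (starRingEnd ℂ) (bb N a a (p + q)) * (z p * a q) := by
    have : ∀ k, bb N z a k = ∑ p ∈ latticeBall N, ∑ q ∈ latticeBall N,
      (if p + q = k then z p * a q else 0) := fun k => rfl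
    simp only [this, Finset.mul_sum, mul_ite, mul_zero]
    rw [Finset.sum_comm]
    apply Finset.sum_congr rfl; intro p hp
    rw [Finset.sum_comm]
    apply Finset.sum_congr rfl; intro q hq
    rw [Finset.sum_ite_eq, if_pos]
    exact Finset.mem_image.2 ⟨(p, q), Finset.mem_product.2 ⟨hp, hq⟩, rfl⟩
  rw [h1]
  apply Finset.sum_congr rfl; intro p hp
  have h2 : ∑ q ∈ latticeBall N, (starRingEnd ℂ) (a q) * bb N a a (p + q)
      = cubicTrunc N a p := by
    rw [cubic_on_ball N a p hp]
    simp only [bb, Finset.mul_sum, mul_ite, mul_zero]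
    rw [Finset.sum_comm]
    apply Finset.sum_congr rfl; intro m _
    rw [Finset.sum_comm]
    apply Finset.sum_congr rfl; intro k _
    have : ∀ q, (m + k = p + q) ↔ (m + k - p = q) := by
      intro q; rw [sub_eq_iff_eq_add']
    simp only [this]
    rw [Finset.sum_ite_eq]
    have e : p - m - k = -(m + k - p) := by abel
    have hmem : (m + k - p ∈ latticeBall N) ↔ (p - m - k ∈ latticeBall N) := by
      constructor
      · intro h; rw [e]; exact neg_mem_ball h
      · intro h; have := neg_mem_ball h; rwa [e, neg_neg] at this
    simp only [hmem]
    split_ifs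
    · rw [e, ha]; ring
    · rfl
  rw [← h2, map_sum, Finset.mul_sum]
  apply Finset.sum_congr rfl; intro q _
  rw [map_mul, Complex.conj_conj]; ring

lemma gron (f f' : ℝ → ℝ) (κ T : ℝ) (hd : ∀ t, HasDerivAt f (f' t) t)
    (hle : ∀ t ∈ Set.Icc (0:ℝ) T, f' t ≤ κ * f t) :
    ∀ t ∈ Set.Icc (0:ℝ) T, f t ≤ f 0 * Real.exp (κ * t) := by
  have hd2 : ∀ t, HasDerivAt (fun t => f t * Real.exp (-(κ * t)))
      (f' t * Real.exp (-(κ * t)) + f t * (Real.exp (-(κ * t)) * (-(κ * 1)))) t := by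
    intro t
    exact (hd t).mul (((hasDerivAt_id t).const_mul κ).neg.exp)
  have anti : AntitoneOn (fun t => f t * Real.exp (-(κ * t))) (Set.Icc 0 T) := by
    apply antitoneOn_of_deriv_nonpos (convex_Icc 0 T)
    · exact fun t _ => (hd2 t).continuousAt.continuousWithinAt
    · exact fun t _ => (hd2 t).differentiableAt.differentiableWithinAt
    · intro t ht
      rw [(hd2 t).deriv]
      have := hle t (interior_subset ht)
      have := mul_le_mul_of_nonneg_right this (Real.exp_pos (-(κ * t))).le
      linarith
  intro t ht
  have := anti (Set.left_mem_Icc.2 (ht.1.trans ht.2)) ht ht.1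
  simp only [mul_zero, neg_zero, Real.exp_zero, mul_one] at this
  rw [Real.exp_neg, ← div_eq_mul_inv, div_le_iff₀ (Real.exp_pos _)] at this
  exact this

lemma normsq_deriv {f : ℝ → ℂ} {f' : ℂ} {t : ℝ} (h : HasDerivAt f f' t) :
    HasDerivAt (fun t => ‖f t‖ ^ 2) (2 * ((starRingEnd ℂ) (f t) * f').re) t := by
  have := h.norm_sq
  rw [Complex.inner] at this
  rwa [mul_comm f'] at this

lemma mode_deriv (N : ℕ) (a d : ℝ → Zc → ℂ) (n : Zc) (t : ℝ)
    (hd1 : HasDerivAt (fun t => a t n) (d t n) t)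
    (hd2 : HasDerivAt (fun t => d t n)
      (-(((nsqZ n : ℝ)) : ℂ) * a t n - cubicTrunc N (a t) n) t) :
    HasDerivAt (fun t => ww n * ‖a t n‖ ^ 2 + ‖d t n‖ ^ 2)
      (2 * ((starRingEnd ℂ) (a t n) * d t n).re
        - 2 * ((d t n) * (starRingEnd ℂ) (cubicTrunc N (a t) n)).re) t := by
  refine (((normsq_deriv hd1).const_mul (ww n)).fun_add (normsq_deriv hd2)).congr_deriv ?_
  simp [ww]
  ring

lemma re_le (x y : ℂ) : 2 * ((starRingEnd ℂ) x * y).re ≤ ‖x‖ ^ 2 + ‖y‖ ^ 2 := by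
  have h1 : ((starRingEnd ℂ) x * y).re ≤ ‖x‖ * ‖y‖ := by
    refine (Complex.re_le_norm _).trans ?_
    rw [norm_mul, RCLike.norm_conj]
  nlinarith [sq_nonneg (‖x‖ - ‖y‖)]

lemma re_le' (n : Zc) (x y : ℂ) :
    2 * ((starRingEnd ℂ) x * y).re ≤ ww n * ‖x‖ ^ 2 + ‖y‖ ^ 2 := by
  nlinarith [re_le x y, ww_one_le n, sq_nonneg ‖x‖]

lemma bb_deriv (N : ℕ) (a d : ℝ → Zc → ℂ) (k : Zc) (t : ℝ)
    (hd1 : ∀ n, HasDerivAt (fun t => a t n) (d t n) t) :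
    HasDerivAt (fun t => bb N (a t) (a t) k) (2 * bb N (d t) (a t) k) t := by
  have h : HasDerivAt (fun t => bb N (a t) (a t) k)
      (∑ p ∈ latticeBall N, ∑ q ∈ latticeBall N,
        (if p + q = k then d t p * a t q + a t p * d t q else 0)) t := by
    unfold bb
    apply HasDerivAt.fun_sum; intro p _
    apply HasDerivAt.fun_sum; intro q _
    split_ifs
    · exact (hd1 p).mul (hd1 q)
    · exact hasDerivAt_const _ _
  convert h using 1
  have : bb N (d t) (a t) k = ∑ p ∈ latticeBall N, ∑ q ∈ latticeBall N,
      (if p + q = k then a t p * d t q else 0) := by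
    unfold bb
    rw [Finset.sum_comm]
    apply Finset.sum_congr rfl; intro p _
    apply Finset.sum_congr rfl; intro q _
    rw [add_comm, mul_comm]
  rw [two_mul]
  nth_rw 2 [this]
  unfold bb
  rw [← Finset.sum_add_distrib]
  apply Finset.sum_congr rfl; intro p _
  rw [← Finset.sum_add_distrib]
  apply Finset.sum_congr rfl; intro q _
  split_ifs <;> simp

lemma V_deriv (N : ℕ) (a d : ℝ → Zc → ℂ) (t : ℝ) (herm : HermSymm (a t))
    (hd1 : ∀ n, HasDerivAt (fun t => a t n) (d t n) t) :
    HasDerivAt (fun t => ∑ k ∈ KK N, ‖bb N (a t) (a t) k‖ ^ 2)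
      (4 * ∑ p ∈ latticeBall N, (d t p * (starRingEnd ℂ) (cubicTrunc N (a t) p)).re) t := by
  have h : HasDerivAt (fun t => ∑ k ∈ KK N, ‖bb N (a t) (a t) k‖ ^ 2)
      (∑ k ∈ KK N, 2 * ((starRingEnd ℂ) (bb N (a t) (a t) k) * (2 * bb N (d t) (a t) k)).re) t := by
    apply HasDerivAt.fun_sum; intro k _
    exact normsq_deriv (bb_deriv N a d k t hd1)
  convert h using 1
  rw [← Complex.re_sum, ← Vid N (d t) (a t) herm, Complex.re_sum, Finset.mul_sum]
  apply Finset.sum_congr rfl; intro k _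
  simp
  ring

lemma V_le (N : ℕ) (a : Zc → ℂ) (herm : HermSymm a) :
    ∑ k ∈ KK N, ‖bb N a a k‖ ^ 2 ≤
      2916 * (∑ p ∈ latticeBall N, ww p * ‖a p‖ ^ 2) ^ 2 := by
  have e : ((∑ k ∈ KK N, ‖bb N a a k‖ ^ 2 : ℝ) : ℂ)
      = ∑ p ∈ latticeBall N, a p * (starRingEnd ℂ) (cubicTrunc N a p) := by
    rw [← Vid N a a herm]
    push_cast
    apply Finset.sum_congr rfl; intro k _
    rw [Complex.conj_mul']
  have h1 : ∑ k ∈ KK N, ‖bb N a a k‖ ^ 2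
      ≤ ∑ p ∈ latticeBall N, ww p ^ (0:ℝ) * ‖a p‖ * ‖cubicTrunc N a p‖ := by
    have h2 := (Complex.re_le_norm ((∑ k ∈ KK N, ‖bb N a a k‖ ^ 2 : ℝ) : ℂ))
    rw [Complex.ofReal_re, e] at h2
    refine h2.trans ((norm_sum_le _ _).trans (le_of_eq ?_))
    apply Finset.sum_congr rfl; intro k _
    rw [norm_mul, RCLike.norm_conj, Real.rpow_zero, one_mul]
  refine h1.trans ((NL 0 le_rfl N a a).trans ?_)
  simp only [zero_div, Real.rpow_zero, one_mul, mul_one]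
  have h0 : 0 ≤ ∑ p ∈ latticeBall N, ww p * ‖a p‖ ^ 2 :=
    Finset.sum_nonneg fun p _ => mul_nonneg (ww_pos p).le (sq_nonneg _)
  have h3 : ∑ q ∈ latticeBall N, (ww q * ‖a q‖ ^ 2 + ‖a q‖ ^ 2)
      ≤ 2 * ∑ p ∈ latticeBall N, ww p * ‖a p‖ ^ 2 := by
    rw [Finset.mul_sum]
    apply Finset.sum_le_sum; intro q _
    nlinarith [ww_one_le q, sq_nonneg ‖a q‖]
  nlinarith [mul_le_mul_of_nonneg_left h3 h0]

lemma core_h1 (N : ℕ) (a d : ℝ → Zc → ℂ)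
    (hd1 : ∀ t n, HasDerivAt (fun t => a t n) (d t n) t)
    (hd2 : ∀ t n, HasDerivAt (fun t => d t n)
      (-(((nsqZ n : ℝ)) : ℂ) * a t n - cubicTrunc N (a t) n) t)
    (herm : ∀ t, HermSymm (a t)) (R T : ℝ)
    (h0 : ∑ n ∈ latticeBall N, (ww n * ‖a 0 n‖ ^ 2 + ‖d 0 n‖ ^ 2) ≤ R ^ 2) :
    ∀ t ∈ Set.Icc (0:ℝ) T, ∑ n ∈ latticeBall N, ww n * ‖a t n‖ ^ 2
      ≤ (R ^ 2 + 1458 * R ^ 4) * Real.exp T := by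
  have hG : ∀ t, HasDerivAt (fun t => ∑ n ∈ latticeBall N, (ww n * ‖a t n‖ ^ 2 + ‖d t n‖ ^ 2)
      + 1 / 2 * ∑ k ∈ KK N, ‖bb N (a t) (a t) k‖ ^ 2)
      (∑ n ∈ latticeBall N, 2 * ((starRingEnd ℂ) (a t n) * d t n).re) t := by
    intro t
    have h1 : HasDerivAt (fun t => ∑ n ∈ latticeBall N, (ww n * ‖a t n‖ ^ 2 + ‖d t n‖ ^ 2))
        (∑ n ∈ latticeBall N, (2 * ((starRingEnd ℂ) (a t n) * d t n).re
        - 2 * ((d t n) * (starRingEnd ℂ) (cubicTrunc N (a t) n)).re)) t := by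
      apply HasDerivAt.fun_sum; intro n _
      exact mode_deriv N a d n t (hd1 t n) (hd2 t n)
    refine (h1.fun_add ((V_deriv N a d t (herm t) (hd1 t)).const_mul (1 / 2))).congr_deriv ?_
    rw [Finset.sum_sub_distrib, ← Finset.mul_sum, ← Finset.mul_sum]
    ring
  have Vnn : ∀ t, 0 ≤ ∑ k ∈ KK N, ‖bb N (a t) (a t) k‖ ^ 2 := fun t =>
    Finset.sum_nonneg fun k _ => sq_nonneg _
  have hgr := gron _ _ 1 T hG (by
    intro t _
    have : ∑ n ∈ latticeBall N, 2 * ((starRingEnd ℂ) (a t n) * d t n).re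
        ≤ ∑ n ∈ latticeBall N, (ww n * ‖a t n‖ ^ 2 + ‖d t n‖ ^ 2) :=
      Finset.sum_le_sum fun n _ => re_le' n _ _
    linarith [Vnn t])
  intro t ht
  have h1 := hgr t ht
  have h2 : ∑ n ∈ latticeBall N, ww n * ‖a t n‖ ^ 2
      ≤ ∑ n ∈ latticeBall N, (ww n * ‖a t n‖ ^ 2 + ‖d t n‖ ^ 2) :=
    Finset.sum_le_sum fun n _ => by linarith [sq_nonneg ‖d t n‖]
  have h3 : ∑ n ∈ latticeBall N, ww n * ‖a 0 n‖ ^ 2 ≤ R ^ 2 :=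
    le_trans (Finset.sum_le_sum fun n _ => by linarith [sq_nonneg ‖d 0 n‖]) h0
  have h30 : 0 ≤ ∑ n ∈ latticeBall N, ww n * ‖a 0 n‖ ^ 2 :=
    Finset.sum_nonneg fun p _ => mul_nonneg (ww_pos p).le (sq_nonneg _)
  have h4 := V_le N (a 0) (herm 0)
  have h5 : (∑ n ∈ latticeBall N, ww n * ‖a 0 n‖ ^ 2) ^ 2 ≤ R ^ 4 := by
    calc _ ≤ (R ^ 2) ^ 2 := pow_le_pow_left₀ h30 h3 2
      _ = R ^ 4 := by ring
  have h6 : Real.exp (1 * t) ≤ Real.exp T := Real.exp_le_exp.2 (by linarith [ht.2])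
  have h7 : ∑ n ∈ latticeBall N, (ww n * ‖a 0 n‖ ^ 2 + ‖d 0 n‖ ^ 2)
      + 1 / 2 * ∑ k ∈ KK N, ‖bb N (a 0) (a 0) k‖ ^ 2 ≤ R ^ 2 + 1458 * R ^ 4 := by linarith
  have h8 := mul_le_mul h7 h6 (Real.exp_pos _).le (by positivity)
  linarith [Vnn t]

def kap (s R T : ℝ) : ℝ :=
  1 + 2 * ((1458 * (9:ℝ) ^ (s / 2)) * ((R ^ 2 + 1458 * R ^ 4) * Real.exp T))

lemma kap_one_le (s R T : ℝ) : 1 ≤ kap s R T := by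
  unfold kap
  have : 0 ≤ 2 * ((1458 * (9:ℝ) ^ (s / 2)) * ((R ^ 2 + 1458 * R ^ 4) * Real.exp T)) := by
    positivity
  linarith

lemma core_s (s : ℝ) (hs : 0 ≤ s) (N : ℕ) (a d : ℝ → Zc → ℂ)
    (hd1 : ∀ t n, HasDerivAt (fun t => a t n) (d t n) t)
    (hd2 : ∀ t n, HasDerivAt (fun t => d t n)
      (-(((nsqZ n : ℝ)) : ℂ) * a t n - cubicTrunc N (a t) n) t)
    (herm : ∀ t, HermSymm (a t)) (R T : ℝ)
    (h0 : ∑ n ∈ latticeBall N, ww n ^ s * (ww n * ‖a 0 n‖ ^ 2 + ‖d 0 n‖ ^ 2) ≤ R ^ 2) :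
    ∀ t ∈ Set.Icc (0:ℝ) T,
      ∑ n ∈ latticeBall N, ww n ^ s * (ww n * ‖a t n‖ ^ 2 + ‖d t n‖ ^ 2)
      ≤ (∑ n ∈ latticeBall N, ww n ^ s * (ww n * ‖a 0 n‖ ^ 2 + ‖d 0 n‖ ^ 2))
        * Real.exp (kap s R T * t) := by
  have enn : ∀ t n, 0 ≤ ww n * ‖a t n‖ ^ 2 + ‖d t n‖ ^ 2 := fun t n => by
    have := (ww_pos n).le
    positivity
  have w1 : ∀ n, 1 ≤ ww n ^ s := fun n => Real.one_le_rpow (ww_one_le n) hs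
  have hK := core_h1 N a d hd1 hd2 herm R T (le_trans (Finset.sum_le_sum fun n _ => by
    nlinarith [enn 0 n, w1 n]) h0)
  refine gron _ (fun t => ∑ n ∈ latticeBall N, ww n ^ s *
      (2 * ((starRingEnd ℂ) (a t n) * d t n).re
        - 2 * ((d t n) * (starRingEnd ℂ) (cubicTrunc N (a t) n)).re)) _ T ?_ ?_
  · intro t
    apply HasDerivAt.fun_sum; intro n _
    exact (mode_deriv N a d n t (hd1 t n) (hd2 t n)).const_mul _
  · intro t ht
    have hNL := NL s hs N (a t) (d t)
    set S := ∑ n ∈ latticeBall N, ww n ^ s * (ww n * ‖a t n‖ ^ 2 + ‖d t n‖ ^ 2) with hS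
    have Snn : 0 ≤ S := Finset.sum_nonneg fun n _ =>
      mul_nonneg (by linarith [w1 n]) (enn t n)
    have h1 : ∑ n ∈ latticeBall N, ww n ^ s *
      (2 * ((starRingEnd ℂ) (a t n) * d t n).re
        - 2 * ((d t n) * (starRingEnd ℂ) (cubicTrunc N (a t) n)).re)
        ≤ S + 2 * ∑ n ∈ latticeBall N, ww n ^ s * ‖d t n‖ * ‖cubicTrunc N (a t) n‖ := by
      rw [hS, Finset.mul_sum, ← Finset.sum_add_distrib]
      apply Finset.sum_le_sum; intro n _
      have e1 := re_le' n (a t n) (d t n)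
      have e2 : -((d t n) * (starRingEnd ℂ) (cubicTrunc N (a t) n)).re
          ≤ ‖d t n‖ * ‖cubicTrunc N (a t) n‖ := by
        refine (neg_le_abs _).trans ((Complex.abs_re_le_norm _).trans ?_)
        rw [norm_mul, RCLike.norm_conj]
      have := mul_le_mul_of_nonneg_left (show (2 * ((starRingEnd ℂ) (a t n) * d t n).re
        - 2 * ((d t n) * (starRingEnd ℂ) (cubicTrunc N (a t) n)).re) ≤
        (ww n * ‖a t n‖ ^ 2 + ‖d t n‖ ^ 2) + 2 * (‖d t n‖ * ‖cubicTrunc N (a t) n‖) by linarith)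
        (show 0 ≤ ww n ^ s by linarith [w1 n])
      linarith
    refine h1.trans ?_
    have h2 : (1458 * (9:ℝ) ^ (s / 2)) * ((∑ p ∈ latticeBall N, ww p * ‖a t p‖ ^ 2) * S)
        ≤ (1458 * (9:ℝ) ^ (s / 2)) * (((R ^ 2 + 1458 * R ^ 4) * Real.exp T) * S) := by
      gcongr
      exact hK t ht
    unfold kap
    linarith

lemma high_mode (N : ℕ) (a d : ℝ → Zc → ℂ)
    (hd1 : ∀ t n, HasDerivAt (fun t => a t n) (d t n) t)
    (hd2 : ∀ t n, HasDerivAt (fun t => d t n)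
      (-(((nsqZ n : ℝ)) : ℂ) * a t n - cubicTrunc N (a t) n) t)
    (n : Zc) (hn : n ∉ latticeBall N) (T : ℝ) :
    ∀ t ∈ Set.Icc (0:ℝ) T,
      ww n * ‖a t n‖ ^ 2 + ‖d t n‖ ^ 2
      ≤ (ww n * ‖a 0 n‖ ^ 2 + ‖d 0 n‖ ^ 2) * Real.exp (1 * t) := by
  refine gron _ _ 1 T (fun t => mode_deriv N a d n t (hd1 t n) (hd2 t n)) ?_
  intro t _
  have : cubicTrunc N (a t) n = 0 := by
    rw [mem_ball] at hn
    rw [cubicTrunc, if_neg hn]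
  rw [this]
  simp only [map_zero, mul_zero, Complex.zero_re, sub_zero]
  linarith [re_le' n (a t n) (d t n)]

lemma hNorm_combine (σ : ℝ) (x y : Zc → ℂ) :
    hNormSq σ x + hNormSq (σ - 1) y
      = ∑' n, ENNReal.ofReal (ww n ^ (σ - 1) * (ww n * ‖x n‖ ^ 2 + ‖y n‖ ^ 2)) := by
  unfold hNormSq
  rw [← ENNReal.tsum_add]
  apply tsum_congr; intro n
  have hw := ww_pos n
  have hsq : ∀ z : ℂ, (‖z‖₊ : ℝ≥0∞) ^ 2 = ENNReal.ofReal (‖z‖ ^ 2) := by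
    intro z
    rw [ENNReal.ofReal_pow (norm_nonneg _), ofReal_norm]; rfl
  have e : ww n ^ σ = ww n ^ (σ - 1) * ww n := by
    rw [← Real.rpow_add_one hw.ne']; congr 1; ring
  change ENNReal.ofReal (ww n ^ σ) * _ + ENNReal.ofReal (ww n ^ (σ - 1)) * _ = _
  rw [hsq, hsq, ← ENNReal.ofReal_mul (by positivity), ← ENNReal.ofReal_mul (by positivity),
    ← ENNReal.ofReal_add (by positivity) (by positivity), e]
  congr 1; ring

lemma tsum_split (B : Finset Zc) (f : Zc → ℝ≥0∞) :
    ∑' n, f n = ∑ n ∈ B, f n + ∑' n, (if n ∈ B then 0 else f n) := by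
  have h1 : ∑ n ∈ B, f n = ∑' n, (if n ∈ B then f n else 0) := by
    rw [tsum_eq_sum (s := B) (fun n hn => if_neg hn)]
    exact Finset.sum_congr rfl (fun n hn => (if_pos hn).symm)
  rw [h1, ← ENNReal.tsum_add]
  apply tsum_congr; intro n
  split_ifs <;> simp

lemma tsum_compare (B : Finset Zc) (f g : Zc → ℝ) (c : ℝ) (hf : ∀ n, 0 ≤ f n)
    (hg : ∀ n, 0 ≤ g n) (hlow : ∑ n ∈ B, f n ≤ (∑ n ∈ B, g n) * c)
    (hhigh : ∀ n, n ∉ B → f n ≤ g n * c) :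
    ∑' n, ENNReal.ofReal (f n) ≤ (∑' n, ENNReal.ofReal (g n)) * ENNReal.ofReal c := by
  rw [tsum_split B, tsum_split B (fun n => ENNReal.ofReal (g n)), add_mul]
  apply add_le_add
  · rw [← ENNReal.ofReal_sum_of_nonneg (fun n _ => hf n),
      ← ENNReal.ofReal_sum_of_nonneg (fun n _ => hg n),
      ← ENNReal.ofReal_mul (Finset.sum_nonneg fun n _ => hg n)]
    exact ENNReal.ofReal_le_ofReal hlow
  · rw [← ENNReal.tsum_mul_right]
    apply ENNReal.tsum_le_tsum
    intro n
    split_ifs with h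
    · simp
    · rw [← ENNReal.ofReal_mul (hg n)]
      exact ENNReal.ofReal_le_ofReal (hhigh n h)

/-- Uniform-in-`N` growth bound for the truncated NLW (Lemma 2.5(i) of the paper):
solutions starting in the ball of radius `R` of `𝓗^σ = h^σ × h^{σ−1}` remain in a ball of
radius `C = C(R,T,σ)` on `[0,T]`, uniformly in the truncation parameter `N`. -/
theorem truncated_nlw_growth_bound (σ : ℝ) (hσ : 1 ≤ σ) :
    ∀ R T : ℝ, 0 < R → 0 < T → ∃ C : ℝ, 0 < C ∧
      ∀ (N : ℕ) (a₀ b₀ : (Fin 3 → ℤ) → ℂ),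
        HermSymm a₀ → HermSymm b₀ →
        hNormSq σ a₀ + hNormSq (σ - 1) b₀ ≤ ENNReal.ofReal (R^2) →
        ∀ a : ℝ → (Fin 3 → ℤ) → ℂ,
          (∀ n, ContDiff ℝ 2 (fun t => a t n)) →
          (∀ n, a 0 n = a₀ n) →
          (∀ n, deriv (fun t => a t n) 0 = b₀ n) →
          (∀ t, HermSymm (a t)) →
          (∀ t n, deriv (deriv (fun t' => a t' n)) t
            = -(((nsqZ n : ℝ)) : ℂ) * a t n - cubicTrunc N (a t) n) →
          (∃ M : ℝ≥0∞, M ≠ ⊤ ∧ ∀ t ∈ Set.Icc (0:ℝ) T,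
              hNormSq σ (a t) ^ (1/2 : ℝ)
                + hNormSq (σ - 1) (fun n => deriv (fun t' => a t' n) t) ^ (1/2 : ℝ) ≤ M) →
          ∀ t ∈ Set.Icc (0:ℝ) T,
            hNormSq σ (a t) + hNormSq (σ - 1) (fun n => deriv (fun t' => a t' n) t)
              ≤ ENNReal.ofReal (C^2) := by
  intro R T hR hT
  have hs : 0 ≤ σ - 1 := by linarith
  refine ⟨R * Real.exp (kap (σ - 1) R T * T / 2), by positivity, ?_⟩
  intro N a₀ b₀ _ _ hinit a hC ha0 hb0 herm hode _ t ht
  set d : ℝ → Zc → ℂ := fun t n => deriv (fun t' => a t' n) t with hd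
  have hd1 : ∀ t n, HasDerivAt (fun t => a t n) (d t n) t := fun t n =>
    (((hC n).differentiable (by norm_num)) t).hasDerivAt
  have hd2 : ∀ t n, HasDerivAt (fun t => d t n)
      (-(((nsqZ n : ℝ)) : ℂ) * a t n - cubicTrunc N (a t) n) t := by
    intro t n
    rw [← hode t n]
    have h1 : ContDiff ℝ 1 (deriv (fun t' => a t' n)) := by
      have h2 : ContDiff ℝ (1 + 1) (fun t' => a t' n) := by
        have := hC n
        norm_num; exact this
      exact (contDiff_succ_iff_deriv.1 h2).2.2
    exact ((h1.differentiable (by norm_num)) t).hasDerivAt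
  set κ := kap (σ - 1) R T with hκ
  have hκ1 : 1 ≤ κ := kap_one_le _ _ _
  set e : ℝ → Zc → ℝ := fun t n => ww n ^ (σ - 1) * (ww n * ‖a t n‖ ^ 2 + ‖d t n‖ ^ 2) with he
  have enn : ∀ t n, 0 ≤ e t n := fun t n => by
    have := ww_pos n
    positivity
  have hA0 : a 0 = a₀ := funext ha0
  have hB0 : d 0 = b₀ := funext hb0
  rw [← hA0, ← hB0, hNorm_combine] at hinit
  change hNormSq σ (a t) + hNormSq (σ - 1) (d t) ≤ _
  rw [hNorm_combine]
  change ∑' n, ENNReal.ofReal (e t n) ≤ _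
  change ∑' n, ENNReal.ofReal (e 0 n) ≤ _ at hinit
  have h0 : ∑ n ∈ latticeBall N, e 0 n ≤ R ^ 2 := by
    have := (ENNReal.sum_le_tsum (latticeBall N)).trans hinit
    rw [← ENNReal.ofReal_sum_of_nonneg (fun n _ => enn 0 n)] at this
    exact (ENNReal.ofReal_le_ofReal_iff (by positivity)).1 this
  have hexp : Real.exp (κ * t) ≤ Real.exp (κ * T) :=
    Real.exp_le_exp.2 (mul_le_mul_of_nonneg_left ht.2 (by linarith))
  have hlow : ∑ n ∈ latticeBall N, e t n ≤ (∑ n ∈ latticeBall N, e 0 n) * Real.exp (κ * T) :=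
    (core_s (σ - 1) hs N a d hd1 hd2 herm R T h0 t ht).trans
      (mul_le_mul_of_nonneg_left hexp (Finset.sum_nonneg fun n _ => enn 0 n))
  have hhigh : ∀ n, n ∉ latticeBall N → e t n ≤ e 0 n * Real.exp (κ * T) := by
    intro n hn
    have h1 := high_mode N a d hd1 hd2 n hn T t ht
    have h2 : Real.exp (1 * t) ≤ Real.exp (κ * T) :=
      le_trans (Real.exp_le_exp.2 (mul_le_mul_of_nonneg_right hκ1 ht.1)) hexp
    have hw : 0 ≤ ww n ^ (σ - 1) := Real.rpow_nonneg (ww_pos n).le _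
    have h3 : 0 ≤ ww n * ‖a 0 n‖ ^ 2 + ‖d 0 n‖ ^ 2 := by
      have := (ww_pos n).le
      positivity
    have h4 := mul_le_mul_of_nonneg_left (h1.trans (mul_le_mul_of_nonneg_left h2 h3)) hw
    simp only [he]
    linarith
  have key : ∑' n, ENNReal.ofReal (e t n)
      ≤ (∑' n, ENNReal.ofReal (e 0 n)) * ENNReal.ofReal (Real.exp (κ * T)) :=
    tsum_compare (latticeBall N) (e t) (e 0) _ (enn t) (enn 0) hlow hhigh
  refine key.trans ((mul_le_mul' hinit le_rfl).trans ?_)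
  rw [← ENNReal.ofReal_mul (by positivity)]
  apply ENNReal.ofReal_le_ofReal
  apply le_of_eq
  have hx : Real.exp (κ * T) = Real.exp (κ * T / 2) * Real.exp (κ * T / 2) := by
    rw [← Real.exp_add]; congr 1; ring
  rw [hx]; ring
end
end
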